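/- arXiv:1208.6267 — 4 statements merged into one kernel-verified Lean document; each statement's English description precedes it below -/
import Mathlib

section
/- Let R be a noetherian noncommutative unique factorization ring (UFR). Then every nonzero normal element of R can be expressed in the form c·p₁·p₂·⋯·pₙ (with n ≥ 0) for some unit c ∈ R and some normal elements pᵢ ∈ R such that each ideal R·pᵢ is a prime ideal. If moreover R is a domain and a noncommutative unique factorization domain (UFD), then the pᵢ can be taken to be prime elements of R. -/
/-! Basic notions for noncommutative unique factorization (Chatters–Jordan),
following the paper "From quantum Ore extensions to quantum tori via
noncommutative UFDs" by Goodearl–Yakimov. -/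

/-- `u` is a normal element of `R`: `uR = Ru`. -/
def IsNormalElem {R : Type*} [Ring R] (u : R) : Prop :=
  {y : R | ∃ t : R, y = u * t} = {y : R | ∃ t : R, y = t * u}

/-- For a normal element `u`, `u ∣ a` means `a ∈ Ru`. -/
def NDvd {R : Type*} [Ring R] (u a : R) : Prop := ∃ t : R, a = t * u

/-- A prime element of a domain `R`: a nonzero normal element `p` such that `Rp`
is a completely prime ideal of `R`; in particular `p` is not a unit
(`1 ∉ Rp`). -/
def IsPrimeElem {R : Type*} [Ring R] (p : R) : Prop :=
  p ≠ 0 ∧ IsNormalElem p ∧ ¬ NDvd p 1 ∧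
    ∀ a b : R, NDvd p (a * b) → NDvd p a ∨ NDvd p b

/-- `S` is a two-sided ideal of `R`, as a set. -/
def IsIdealSet {R : Type*} [Ring R] (S : Set R) : Prop :=
  (0 : R) ∈ S ∧ (∀ a ∈ S, ∀ b ∈ S, a + b ∈ S) ∧
    ∀ r : R, ∀ a ∈ S, r * a ∈ S ∧ a * r ∈ S

/-- `S` is a prime two-sided ideal of `R` (elementwise characterization:
`aRb ⊆ S` implies `a ∈ S` or `b ∈ S`, and `S` is proper). -/
def IsPrimeIdealSet {R : Type*} [Ring R] (S : Set R) : Prop :=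
  IsIdealSet S ∧ (1 : R) ∉ S ∧
    ∀ a b : R, (∀ t : R, a * t * b ∈ S) → a ∈ S ∨ b ∈ S

/-- A prime ring: `aRb = 0` implies `a = 0` or `b = 0`. -/
def IsPrimeRing (R : Type*) [Ring R] : Prop :=
  ∀ a b : R, (∀ t : R, a * t * b = 0) → a = 0 ∨ b = 0

/-- Noncommutative unique factorization ring: a prime ring in which every
nonzero prime ideal contains a nonzero prime ideal generated by a normal
element. -/
def IsUFR (R : Type*) [Ring R] : Prop :=
  IsPrimeRing R ∧
    ∀ S : Set R, IsPrimeIdealSet S → S ≠ {0} →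
      ∃ u : R, u ≠ 0 ∧ IsNormalElem u ∧
        IsPrimeIdealSet {y : R | ∃ t : R, y = t * u} ∧
        {y : R | ∃ t : R, y = t * u} ⊆ S

/-- Noncommutative unique factorization domain condition: every nonzero prime
ideal contains a prime element. -/
def IsNCUFD (R : Type*) [Ring R] : Prop :=
  ∀ S : Set R, IsPrimeIdealSet S → S ≠ {0} → ∃ p ∈ S, IsPrimeElem p

theorem isNormalElem_iff {R : Type*} [Ring R] {u : R} :
    IsNormalElem u ↔ (∀ t, ∃ s, u * t = s * u) ∧ ∀ t, ∃ s, t * u = u * s := by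
  constructor
  · intro h
    refine ⟨fun t => ?_, fun t => ?_⟩
    · have : u * t ∈ {y : R | ∃ t : R, y = t * u} := h ▸ ⟨t, rfl⟩
      exact this
    · have : t * u ∈ {y : R | ∃ t : R, y = u * t} := h.symm ▸ ⟨t, rfl⟩
      exact this
  · rintro ⟨h₁, h₂⟩
    ext y
    constructor
    · rintro ⟨t, rfl⟩
      exact h₁ t
    · rintro ⟨t, rfl⟩
      exact h₂ t

namespace IsNormalElem

variable {R : Type*} [Ring R] {u v p : R}

theorem exists_mul_left (h : IsNormalElem u) (t : R) : ∃ s, u * t = s * u :=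
  (isNormalElem_iff.1 h).1 t

theorem exists_mul_right (h : IsNormalElem u) (t : R) : ∃ s, t * u = u * s :=
  (isNormalElem_iff.1 h).2 t

protected theorem one : IsNormalElem (1 : R) :=
  isNormalElem_iff.2 ⟨fun t => ⟨t, by simp⟩, fun t => ⟨t, by simp⟩⟩

protected theorem mul (hu : IsNormalElem u) (hv : IsNormalElem v) :
    IsNormalElem (u * v) := by
  refine isNormalElem_iff.2 ⟨fun t => ?_, fun t => ?_⟩
  · obtain ⟨s, hs⟩ := hv.exists_mul_left t
    obtain ⟨s', hs'⟩ := hu.exists_mul_left s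
    exact ⟨s', by rw [mul_assoc, hs, ← mul_assoc, hs', mul_assoc]⟩
  · obtain ⟨s, hs⟩ := hu.exists_mul_right t
    obtain ⟨s', hs'⟩ := hv.exists_mul_right s
    exact ⟨s', by rw [← mul_assoc, hs, mul_assoc, hs', mul_assoc]⟩

theorem map (h : IsNormalElem u) (σ : R ≃+* R) : IsNormalElem (σ u) := by
  refine isNormalElem_iff.2 ⟨fun t => ?_, fun t => ?_⟩
  · obtain ⟨s, hs⟩ := h.exists_mul_left (σ.symm t)
    exact ⟨σ s, by simpa using congrArg σ hs⟩
  · obtain ⟨s, hs⟩ := h.exists_mul_right (σ.symm t)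
    exact ⟨σ s, by simpa using congrArg σ hs⟩

theorem isIdealSet (h : IsNormalElem u) : IsIdealSet {y : R | ∃ t : R, y = t * u} := by
  refine ⟨⟨0, by simp⟩, ?_, ?_⟩
  · rintro _ ⟨a, rfl⟩ _ ⟨b, rfl⟩
    exact ⟨a + b, by rw [add_mul]⟩
  · rintro r _ ⟨a, rfl⟩
    refine ⟨⟨r * a, by rw [mul_assoc]⟩, ?_⟩
    obtain ⟨s, hs⟩ := h.exists_mul_left r
    exact ⟨a * s, by rw [mul_assoc, hs, mul_assoc]⟩

theorem isUnit_of_mul_eq (h : IsNormalElem u) {r c : R} (hc : IsUnit c) (hr : r * u = c) :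
    IsUnit u := by
  obtain ⟨d, hd⟩ := hc.exists_left_inv
  have hl : d * r * u = 1 := by rw [mul_assoc, hr, hd]
  obtain ⟨s, hs⟩ := h.exists_mul_right (d * r)
  exact isUnit_iff_exists_and_exists.2 ⟨⟨s, hs ▸ hl⟩, ⟨d * r, hl⟩⟩

theorem isRegular (hR : IsPrimeRing R) (h : IsNormalElem p) (h0 : p ≠ 0) : IsRegular p := by
  constructor
  · refine (isLeftRegular_iff_right_eq_zero_of_mul).2 fun a ha => ?_
    refine (hR p a fun t => ?_).resolve_left h0
    obtain ⟨s, hs⟩ := h.exists_mul_left t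
    rw [hs, mul_assoc, ha, mul_zero]
  · refine (isRightRegular_iff_left_eq_zero_of_mul).2 fun a ha => ?_
    refine (hR a p fun t => ?_).resolve_right h0
    obtain ⟨s, hs⟩ := h.exists_mul_right t
    rw [mul_assoc, hs, ← mul_assoc, ha, zero_mul]

/-- Conjugation by a regular normal element is an automorphism. -/
theorem exists_ringEquiv (h : IsNormalElem p) (hp : IsRegular p) :
    ∃ σ : R ≃+* R, ∀ t, p * t = σ t * p := by
  choose f hf using h.exists_mul_left
  choose g hg using h.exists_mul_right
  refine ⟨{ toFun := f, invFun := g, left_inv := fun t => ?_, right_inv := fun t => ?_,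
            map_mul' := fun a b => ?_, map_add' := fun a b => ?_ }, hf⟩
  · exact hp.left (by simp only [← hg, ← hf])
  · exact hp.right (by simp only [← hg, ← hf])
  · exact hp.right (by simp only [← hf, mul_assoc]; rw [← mul_assoc, hf, mul_assoc])
  · exact hp.right (by simp only [← hf, add_mul, mul_add])

theorem of_mul_right (hv : IsNormalElem v) (hreg : IsRegular v) (huv : IsNormalElem (u * v)) :
    IsNormalElem u := by
  refine isNormalElem_iff.2 ⟨fun t => ?_, fun t => ?_⟩
  · obtain ⟨s, hs⟩ := hv.exists_mul_right t
    obtain ⟨s', hs'⟩ := huv.exists_mul_left s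
    exact ⟨s', hreg.right (by simp only [mul_assoc] at hs' ⊢; rw [hs, hs'])⟩
  · obtain ⟨s, hs⟩ := huv.exists_mul_right t
    obtain ⟨s', hs'⟩ := hv.exists_mul_left s
    exact ⟨s', hreg.right (by simp only [mul_assoc] at hs ⊢; rw [hs, hs'])⟩

end IsNormalElem

theorem IsPrimeIdealSet.map_principal {R : Type*} [Ring R] {p : R}
    (h : IsPrimeIdealSet {y : R | ∃ t : R, y = t * p}) (hp : IsNormalElem p) (σ : R ≃+* R) :
    IsPrimeIdealSet {y : R | ∃ t : R, y = t * σ p} := by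
  have key : ∀ y, (∃ t, y = t * σ p) ↔ ∃ t, σ.symm y = t * p := fun y =>
    ⟨fun ⟨t, ht⟩ => ⟨σ.symm t, by simp [ht]⟩, fun ⟨t, ht⟩ => ⟨σ t, by simp [← map_mul, ← ht]⟩⟩
  refine ⟨(hp.map σ).isIdealSet, fun h1 => h.2.1 ?_, fun a b hab => ?_⟩
  · simpa using (key 1).1 h1
  · simp only [Set.mem_ofPred_eq, key] at hab ⊢
    refine h.2.2 _ _ fun t => ?_
    simpa using hab (σ t)

theorem IsPrimeElem.isPrimeIdealSet {R : Type*} [Ring R] {p : R} (h : IsPrimeElem p) :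
    IsPrimeIdealSet {y : R | ∃ t : R, y = t * p} :=
  ⟨h.2.1.isIdealSet, h.2.2.1, fun a b hab =>
    h.2.2.2 a b (by simpa [NDvd] using hab 1)⟩

theorem IsPrimeElem.map {R : Type*} [Ring R] {p : R} (h : IsPrimeElem p) (σ : R ≃+* R) :
    IsPrimeElem (σ p) := by
  have key : ∀ y, NDvd (σ p) y ↔ NDvd p (σ.symm y) := fun y =>
    ⟨fun ⟨t, ht⟩ => ⟨σ.symm t, by simp [ht]⟩, fun ⟨t, ht⟩ => ⟨σ t, by simp [← map_mul, ← ht]⟩⟩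
  refine ⟨by simpa using h.1, h.2.1.map σ, by simpa [key] using h.2.2.1, fun a b hab => ?_⟩
  rw [key] at hab ⊢
  rw [key]
  exact h.2.2.2 _ _ (by simpa using hab)

/-- `x` is a unit times a product of elements satisfying `Q`. -/
def IsUnitMulProd {R : Type*} [Ring R] (Q : R → Prop) (x : R) : Prop :=
  ∃ (c : R) (l : List R), IsUnit c ∧ (∀ p ∈ l, Q p) ∧ x = c * l.prod

/-- A class of nonzero normal elements generating prime ideals, stable under automorphisms. -/
structure IsPrimeGeneratorClass {R : Type*} [Ring R] (Q : R → Prop) : Prop where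
  ne_zero : ∀ p, Q p → p ≠ 0
  isNormalElem : ∀ p, Q p → IsNormalElem p
  isPrimeIdealSet : ∀ p, Q p → IsPrimeIdealSet {y : R | ∃ t : R, y = t * p}
  map : ∀ p, Q p → ∀ σ : R ≃+* R, Q (σ p)

namespace IsUnitMulProd

variable {R : Type*} [Ring R] {Q : R → Prop} {x y : R}

protected theorem one : IsUnitMulProd Q (1 : R) := ⟨1, [], by simp⟩

theorem of_isUnit (hx : IsUnit x) : IsUnitMulProd Q x := ⟨x, [], by simpa⟩

theorem of_mem (hx : Q x) : IsUnitMulProd Q x := ⟨1, [x], by simpa⟩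

theorem map (hQ : IsPrimeGeneratorClass Q) (hx : IsUnitMulProd Q x) (σ : R ≃+* R) :
    IsUnitMulProd Q (σ x) := by
  obtain ⟨c, l, hc, hl, rfl⟩ := hx
  refine ⟨σ c, l.map σ, hc.map σ, fun p hp => ?_, by rw [map_mul, map_list_prod]⟩
  obtain ⟨q, hq, rfl⟩ := List.mem_map.1 hp
  exact hQ.map q (hl q hq) σ

protected theorem mul (hR : IsPrimeRing R) (hQ : IsPrimeGeneratorClass Q)
    (hx : IsUnitMulProd Q x) (hy : IsUnitMulProd Q y) : IsUnitMulProd Q (x * y) := by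
  have hprod : ∀ l : List R, (∀ p ∈ l, Q p) → IsNormalElem l.prod ∧ IsRegular l.prod := by
    intro l
    induction l with
    | nil => exact fun _ => ⟨by simpa using IsNormalElem.one, by simpa using isRegular_one⟩
    | cons a l ih =>
      intro hl
      obtain ⟨ha, hl⟩ := List.forall_mem_cons.1 hl
      have hn := hQ.isNormalElem a ha
      rw [List.prod_cons]
      exact ⟨hn.mul (ih hl).1, (hn.isRegular hR (hQ.ne_zero a ha)).mul (ih hl).2⟩
  obtain ⟨c, l, hc, hl, rfl⟩ := hx
  obtain ⟨d, m, hd, hm, rfl⟩ := hy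
  obtain ⟨σ, hσ⟩ := (hprod l hl).1.exists_ringEquiv (hprod l hl).2
  refine ⟨c * σ d, l ++ m, hc.mul (hd.map σ), fun p hp => ?_, ?_⟩
  · exact (List.mem_append.1 hp).elim (hl p) (hm p)
  · rw [List.prod_append, mul_assoc c, ← mul_assoc l.prod, hσ]
    simp only [mul_assoc]

/-- A normal right factor of a unit times a product of elements of `Q` is of the same form. -/
theorem of_mul_eq (hR : IsPrimeRing R) (hQ : IsPrimeGeneratorClass Q) {c : R} (hc : IsUnit c)
    (l : List R) : ∀ {r u : R}, (∀ p ∈ l, Q p) → IsNormalElem u → r * u = c * l.prod →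
      IsUnitMulProd Q u := by
  induction l using List.reverseRecOn with
  | nil =>
    intro r u _ hu h
    exact of_isUnit (hu.isUnit_of_mul_eq hc (by simpa using h))
  | append_singleton l p ih =>
    intro r u hl hu h
    have hp : Q p := hl p (by simp)
    replace hl : ∀ q ∈ l, Q q := fun q hq => hl q (by simp [hq])
    have hn := hQ.isNormalElem p hp
    have hreg := hn.isRegular hR (hQ.ne_zero p hp)
    rw [List.prod_append, List.prod_singleton, ← mul_assoc] at h
    have hmem : ∀ t, r * t * u ∈ {y : R | ∃ t : R, y = t * p} := fun t => by
      obtain ⟨s, hs⟩ := hu.exists_mul_right t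
      rw [mul_assoc, hs, ← mul_assoc, h]
      exact (hn.isIdealSet.2.2 s _ ⟨_, rfl⟩).2
    obtain ⟨r', rfl⟩ | ⟨u', rfl⟩ := (hQ.isPrimeIdealSet p hp).2.2 r u hmem
    · obtain ⟨σ, hσ⟩ := hn.exists_ringEquiv hreg
      have hσu : IsUnitMulProd Q (σ u) := ih (r := r') hl (hu.map σ)
        (hreg.right (by simpa only [mul_assoc, hσ] using h))
      simpa using hσu.map hQ σ.symm
    · exact (ih (r := r) hl (hn.of_mul_right hreg hu)
        (hreg.right (by simpa only [mul_assoc] using h))).mul hR hQ (of_mem hp)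

end IsUnitMulProd

/-- An ideal maximal among those containing `u` and avoiding a multiplicative set is prime. -/
theorem exists_isPrimeIdealSet_disjoint {R : Type*} [Ring R] [IsNoetherianRing R]
    {S : Set R} (h1 : 1 ∈ S) (hmul : ∀ a ∈ S, ∀ b ∈ S, a * b ∈ S) {u : R}
    (hu : IsNormalElem u) (hdisj : ∀ r, r * u ∉ S) :
    ∃ P : Set R, IsPrimeIdealSet P ∧ u ∈ P ∧ ∀ s ∈ P, s ∉ S := by
  obtain ⟨P, ⟨hPi, huP, hPS⟩, hmax⟩ :=
    set_has_maximal_iff_noetherian.2 (inferInstance : IsNoetherian R R)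
      {J : Ideal R | IsIdealSet (J : Set R) ∧ u ∈ J ∧ ∀ s ∈ J, s ∉ S}
      ⟨{ carrier := {y : R | ∃ t : R, y = t * u}
         add_mem' := fun ha hb => hu.isIdealSet.2.1 _ ha _ hb
         zero_mem' := hu.isIdealSet.1
         smul_mem' := fun r a ha => (hu.isIdealSet.2.2 r a ha).1 },
        hu.isIdealSet, ⟨1, by simp⟩, by rintro _ ⟨t, rfl⟩; exact hdisj t⟩
  have meets : ∀ J : Ideal R, IsIdealSet (J : Set R) → P ≤ J → ∀ a ∈ J, a ∉ P →
      ∃ s ∈ J, s ∈ S := by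
    intro J hJ hPJ a haJ haP
    by_contra! hcon
    exact hmax J ⟨hJ, hPJ huP, hcon⟩ (lt_of_le_of_ne hPJ (by rintro rfl; exact haP haJ))
  refine ⟨P, ⟨hPi, fun h => hPS 1 h h1, fun a b hab => ?_⟩, huP, hPS⟩
  by_contra! hcon
  obtain ⟨haP, hbP⟩ := hcon
  have mulR : ∀ {x : R} (r : R), x ∈ P → x * r ∈ P := fun r hx => (hPi.2.2 r _ hx).2
  obtain ⟨s, hs, hsS⟩ := meets
    { carrier := {x | ∀ t, x * t * b ∈ P}
      add_mem' := fun hx hy t => by simpa only [add_mul] using P.add_mem (hx t) (hy t)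
      zero_mem' := fun t => by simp
      smul_mem' := fun r x hx t => by
        simpa only [smul_eq_mul, mul_assoc] using Ideal.mul_mem_left P r (hx t) }
    ⟨fun t => by simp, fun x hx y hy t => by
      simpa only [add_mul] using P.add_mem (hx t) (hy t),
      fun r x hx => ⟨fun t => by simpa only [mul_assoc] using Ideal.mul_mem_left P r (hx t),
        fun t => by simpa only [mul_assoc] using hx (r * t)⟩⟩
    (fun x hx t => mulR b (mulR t hx)) a hab haP
  obtain ⟨s', hs', hsS'⟩ := meets
    { carrier := {x | ∀ t, s * t * x ∈ P}
      add_mem' := fun hx hy t => by simpa only [mul_add] using P.add_mem (hx t) (hy t)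
      zero_mem' := fun t => by simp
      smul_mem' := fun r x hx t => by
        simpa only [smul_eq_mul, mul_assoc] using hx (t * r) }
    ⟨fun t => by simp, fun x hx y hy t => by
      simpa only [mul_add] using P.add_mem (hx t) (hy t),
      fun r x hx => ⟨fun t => by simpa only [mul_assoc] using hx (t * r),
        fun t => by simpa only [mul_assoc] using mulR r (hx t)⟩⟩
    (fun x hx t => Ideal.mul_mem_left P _ hx) b hs hbP
  exact hPS (s * s') (by simpa using hs' 1) (hmul s hsS s' hsS')

theorem isUnitMulProd_of_isNormalElem {R : Type*} [Ring R] [IsNoetherianRing R]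
    (hR : IsPrimeRing R) {Q : R → Prop} (hQ : IsPrimeGeneratorClass Q)
    (hex : ∀ P : Set R, IsPrimeIdealSet P → P ≠ {0} → ∃ p ∈ P, Q p)
    {u : R} (h0 : u ≠ 0) (hu : IsNormalElem u) : IsUnitMulProd Q u := by
  by_cases h : ∃ r, IsUnitMulProd Q (r * u)
  · obtain ⟨r, c, l, hc, hl, hr⟩ := h
    exact .of_mul_eq hR hQ hc l hl hu hr
  · push Not at h
    obtain ⟨P, hP, huP, hPS⟩ := exists_isPrimeIdealSet_disjoint (S := {x | IsUnitMulProd Q x})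
      .one (fun _ ha _ hb => ha.mul hR hQ hb) hu h
    obtain ⟨p, hp, hQp⟩ := hex P hP (by rintro rfl; exact h0 huP)
    exact absurd (.of_mem hQp) (hPS p hp)

/-- **Proposition 2.1(a)** of Goodearl–Yakimov: in a noetherian UFR, every
nonzero normal element is a unit multiple of a product of normal elements
generating prime ideals; in a noetherian UFD these factors can be taken to be
prime elements. -/
theorem stmt0 (R : Type*) [Ring R]
    [IsNoetherianRing R] [IsNoetherianRing Rᵐᵒᵖ]
    (hR : IsUFR R) :
    (∀ u : R, u ≠ 0 → IsNormalElem u →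
      ∃ (c : R) (l : List R), IsUnit c ∧
        (∀ p ∈ l, IsNormalElem p ∧
          IsPrimeIdealSet {y : R | ∃ t : R, y = t * p}) ∧
        u = c * l.prod) ∧
    (IsDomain R → IsNCUFD R →
      ∀ u : R, u ≠ 0 → IsNormalElem u →
        ∃ (c : R) (l : List R), IsUnit c ∧ (∀ p ∈ l, IsPrimeElem p) ∧
          u = c * l.prod) := by
  constructor
  · intro u h0 hu
    obtain ⟨c, l, hc, hl, h⟩ := isUnitMulProd_of_isNormalElem hR.1
      (Q := fun p => p ≠ 0 ∧ IsNormalElem p ∧ IsPrimeIdealSet {y : R | ∃ t : R, y = t * p})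
      ⟨fun _ h => h.1, fun _ h => h.2.1, fun _ h => h.2.2, fun _ h σ =>
        ⟨by simpa using h.1, h.2.1.map σ, h.2.2.map_principal h.2.1 σ⟩⟩
      (fun P hP hP0 => by
        obtain ⟨p, hp0, hpn, hpp, hpP⟩ := hR.2 P hP hP0
        exact ⟨p, hpP ⟨1, by simp⟩, hp0, hpn, hpp⟩) h0 hu
    exact ⟨c, l, hc, fun p hp => (hl p hp).2, h⟩
  · intro _ hUFD u h0 hu
    exact isUnitMulProd_of_isNormalElem hR.1
      ⟨fun _ h => h.1, fun _ h => h.2.1, fun _ h => h.isPrimeIdealSet, fun _ h σ => h.map σ⟩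
      hUFD h0 hu
end

section
/- Let R be a noetherian noncommutative unique factorization domain (UFD). Then every nonzero element of R can be expressed in the form c·p₁·p₂·⋯·pₙ (with n ≥ 0) for some prime elements pᵢ ∈ R and some element c ∈ R which has no prime divisors, i.e., no prime element of R divides c. -/
open MulOpposite in
/-- Splitting off a right factor without a left inverse strictly enlarges the generated right
ideal. -/
lemma span_op_mul_lt {R : Type*} [Ring R] [IsDomain R] {t p : R} (h : t * p ≠ 0)
    (hp : ¬ NDvd p 1) :
    Ideal.span {op (t * p)} < Ideal.span {op t} := by
  have ht : t ≠ 0 := left_ne_zero_of_mul h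
  have hp0 : p ≠ 0 := right_ne_zero_of_mul h
  refine lt_of_le_of_ne ?_ fun heq => hp ?_
  · rw [Ideal.span_singleton_le_iff_mem, Ideal.mem_span_singleton']
    exact ⟨op p, rfl⟩
  · have hmem : op t ∈ Ideal.span {op (t * p)} := heq ▸ Ideal.mem_span_singleton_self _
    obtain ⟨s, hs⟩ := Ideal.mem_span_singleton'.mp hmem
    have hts : t * p * s.unop = t := congrArg unop hs
    have hps : p * s.unop = 1 := mul_left_cancel₀ ht (by rw [← mul_assoc, hts, mul_one])
    exact ⟨s.unop, mul_left_cancel₀ hp0 (by rw [← mul_assoc, hps, one_mul, mul_one])⟩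

/-- **Proposition 2.1(b)** of Goodearl–Yakimov: in a noetherian noncommutative
UFD, every nonzero element is a product `c * p₁ ⋯ pₙ` of prime elements `pᵢ`
and an element `c` with no prime divisors. -/
theorem stmt1 (R : Type*) [Ring R] [IsDomain R]
    [IsNoetherianRing R] [IsNoetherianRing Rᵐᵒᵖ]
    (hR : IsNCUFD R) :
    ∀ a : R, a ≠ 0 →
      ∃ (c : R) (l : List R), (∀ p ∈ l, IsPrimeElem p) ∧
        (∀ p : R, IsPrimeElem p → ¬ NDvd p c) ∧
        a = c * l.prod := by
  intro a
  induction a using (InvImage.wf (fun a : R => Ideal.span {MulOpposite.op a})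
    (wellFounded_gt (α := Ideal Rᵐᵒᵖ))).induction with
  | _ a ih =>
    intro ha
    by_cases h : ∃ p : R, IsPrimeElem p ∧ NDvd p a
    · obtain ⟨p, hp, t, rfl⟩ := h
      obtain ⟨c, l, hl, hc, ht⟩ := ih t (span_op_mul_lt ha hp.2.2.1) (left_ne_zero_of_mul ha)
      refine ⟨c, l ++ [p], ?_, hc, ?_⟩
      · simpa [or_imp, forall_and] using ⟨hl, hp⟩
      · rw [List.prod_append, List.prod_singleton, ← mul_assoc, ← ht]
    · push Not at h
      exact ⟨a, [], by simp, h, by simp⟩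
end

section
/- Let R be a noetherian noncommutative unique factorization domain (UFD), and let u be a nonzero, nonunit, normal element of R. Then u is a prime element of R if and only if u is irreducible, that is, whenever u = a·b with a, b ∈ R, either a or b is a unit of R. -/
/-- `IsPrimeProd s` says that `s` is a finite product of prime elements. -/
inductive IsPrimeProd {R : Type*} [Ring R] : R → Prop
  | one : IsPrimeProd 1
  | mul {p s : R} : IsPrimeElem p → IsPrimeProd s → IsPrimeProd (p * s)

theorem IsPrimeProd.mul_mem {R : Type*} [Ring R] {s t : R} (hs : IsPrimeProd s)
    (ht : IsPrimeProd t) : IsPrimeProd (s * t) := by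
  induction hs with
  | one => simpa using ht
  | mul hp _ ih => rw [mul_assoc]; exact .mul hp ih

theorem IsPrimeElem.isPrimeProd {R : Type*} [Ring R] {p : R} (hp : IsPrimeElem p) :
    IsPrimeProd p := by
  simpa using IsPrimeProd.mul hp .one

theorem IsNormalElem.exists_mul_left_s2 {R : Type*} [Ring R] {u : R} (hu : IsNormalElem u)
    (r : R) : ∃ t, u * r = t * u :=
  hu.subset ⟨r, rfl⟩

theorem IsNormalElem.exists_mul_right_s2 {R : Type*} [Ring R] {u : R} (hu : IsNormalElem u)
    (r : R) : ∃ t, r * u = u * t :=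
  hu.superset ⟨r, rfl⟩

theorem IsNormalElem.isTwoSided_span {R : Type*} [Ring R] {u : R} (hu : IsNormalElem u) :
    (Ideal.span {u}).IsTwoSided where
  mul_mem_of_left {a} b ha := by
    obtain ⟨c, rfl⟩ := Ideal.mem_span_singleton'.1 ha
    obtain ⟨d, hd⟩ := hu.exists_mul_left_s2 b
    exact Ideal.mem_span_singleton'.2 ⟨c * d, by rw [mul_assoc, mul_assoc, hd]⟩

/-- A two-sided ideal maximal among those avoiding a multiplicative set is prime. -/
theorem isPrimeIdealSet_of_maximal_avoiding {R : Type*} [Ring R] {S : R → Prop}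
    (one : S 1) (mul : ∀ s t, S s → S t → S (s * t)) {P : Ideal R} [P.IsTwoSided]
    (hP : ∀ s ∈ P, ¬ S s)
    (hmax : ∀ J : Ideal R, J.IsTwoSided → P < J → ∃ s ∈ J, S s) :
    IsPrimeIdealSet (P : Set R) := by
  refine ⟨⟨P.zero_mem, fun a ha b hb => P.add_mem ha hb, fun r a ha =>
    ⟨P.mul_mem_left r ha, P.mul_mem_right r ha⟩⟩, fun h => hP 1 h one, fun a b hab => ?_⟩
  by_contra! hne
  obtain ⟨ha, hb⟩ := hne
  let A : Ideal R :=
    { carrier := {x | ∀ t, x * t * b ∈ P}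
      zero_mem' := fun t => by simp
      add_mem' := fun {x y} hx hy t => by
        simpa [add_mul] using P.add_mem (hx t) (hy t)
      smul_mem' := fun r x hx t => by
        simpa [mul_assoc] using P.mul_mem_left r (hx t) }
  have hA : A.IsTwoSided := ⟨fun {x} r hx t => by simpa [mul_assoc] using hx (r * t)⟩
  obtain ⟨s, hsA, hs⟩ := hmax A hA (SetLike.lt_iff_le_and_exists.2
    ⟨fun x hx t => P.mul_mem_right _ (P.mul_mem_right _ hx), a, hab, ha⟩)
  let B : Ideal R :=
    { carrier := {y | ∀ t, s * t * y ∈ P}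
      zero_mem' := fun t => by simp
      add_mem' := fun {x y} hx hy t => by
        simpa [mul_add] using P.add_mem (hx t) (hy t)
      smul_mem' := fun r x hx t => by
        simpa [mul_assoc] using hx (t * r) }
  have hB : B.IsTwoSided :=
    ⟨fun {x} r hx t => by simpa [mul_assoc] using P.mul_mem_right r (hx t)⟩
  obtain ⟨t, htB, ht⟩ := hmax B hB (SetLike.lt_iff_le_and_exists.2
    ⟨fun x hx t => P.mul_mem_left _ hx, b, hsA, hb⟩)
  exact hP (s * t) (by simpa using htB 1) (mul s t hs ht)

/-- In a noncommutative UFD, every nonzero two-sided ideal contains a product of primes. -/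
theorem IsNCUFD.exists_isPrimeProd_mem {R : Type*} [Ring R] [IsNoetherianRing R]
    (hR : IsNCUFD R) {I : Ideal R} (hI : I.IsTwoSided) (hI0 : I ≠ ⊥) :
    ∃ s ∈ I, IsPrimeProd s := by
  by_contra! h
  obtain ⟨P, ⟨hP2, hIP, hP⟩, hmax⟩ := (wellFounded_gt (α := Ideal R)).has_min
    {J | J.IsTwoSided ∧ I ≤ J ∧ ∀ s ∈ J, ¬ IsPrimeProd s} ⟨I, hI, le_rfl, h⟩
  have hprime : IsPrimeIdealSet (P : Set R) := by
    refine isPrimeIdealSet_of_maximal_avoiding .one (fun _ _ => .mul_mem) hP fun J hJ hPJ => ?_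
    by_contra! hJS
    exact hmax J ⟨hJ, hIP.trans hPJ.le, hJS⟩ hPJ
  obtain ⟨p, hpP, hp⟩ := hR P hprime fun h0 => hI0 <| (Submodule.eq_bot_iff _).2 fun x hx => by
    have hx' : x ∈ (P : Set R) := hIP hx
    rwa [h0] at hx'
  exact hP p hpP hp.isPrimeProd

/-- A right factor of a product of primes is a unit or is divisible by a prime element. -/
theorem IsPrimeProd.isUnit_or_exists_prime_dvd {R : Type*} [Ring R] [IsDomain R] {s : R}
    (hs : IsPrimeProd s) {r u : R} (h : r * u = s) :
    IsUnit u ∨ ∃ p, IsPrimeElem p ∧ NDvd p u := by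
  induction hs generalizing r with
  | one => exact .inl (.of_mul_eq_one_right r h)
  | @mul p s hp _ ih =>
    obtain ⟨t, ht⟩ := hp.2.1.exists_mul_left_s2 s
    rcases hp.2.2.2 r u ⟨t, h.trans ht⟩ with ⟨c, rfl⟩ | hu
    · obtain ⟨d, hd⟩ := hp.2.1.exists_mul_right_s2 c
      rw [hd, mul_assoc] at h
      exact ih (mul_left_cancel₀ hp.1 h)
    · exact .inr ⟨p, hp, hu⟩

theorem IsPrimeElem.isUnit_or_isUnit {R : Type*} [Ring R] [IsDomain R] {u a b : R}
    (hu : IsPrimeElem u) (h : u = a * b) : IsUnit a ∨ IsUnit b := by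
  obtain ⟨hu0, hn, -, hdvd⟩ := hu
  rcases hdvd a b ⟨1, by rw [one_mul, h]⟩ with ⟨t, rfl⟩ | ⟨t, rfl⟩
  · right
    obtain ⟨c, hc⟩ := hn.exists_mul_right_s2 t
    rw [hc, mul_assoc] at h
    exact .of_mul_eq_one_right c (mul_left_cancel₀ hu0 (by rw [← h, mul_one]))
  · left
    rw [← mul_assoc] at h
    exact .of_mul_eq_one t (mul_right_cancel₀ hu0 (by rw [← h, one_mul]))

theorem IsPrimeElem.of_isUnit_mul {R : Type*} [Ring R] [IsDomain R] {p t : R}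
    (hp : IsPrimeElem p) (ht : IsUnit t) (hn : IsNormalElem (t * p)) :
    IsPrimeElem (t * p) := by
  obtain ⟨v, rfl⟩ := ht
  have key (x : R) : NDvd (v * p) x ↔ NDvd p x :=
    ⟨fun ⟨c, hc⟩ => ⟨c * v, by rw [hc, mul_assoc]⟩,
      fun ⟨c, hc⟩ => ⟨c * ↑v⁻¹, by rw [hc, mul_assoc, Units.inv_mul_cancel_left]⟩⟩
  refine ⟨mul_ne_zero v.ne_zero hp.1, hn, ?_, fun a b => ?_⟩
  · rw [key]
    exact hp.2.2.1
  · simpa only [key] using hp.2.2.2 a b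

/-- **Proposition 2.1(c)** of Goodearl–Yakimov: in a noetherian noncommutative
UFD, a nonzero nonunit normal element is prime iff it is irreducible. -/
theorem stmt2 (R : Type*) [Ring R] [IsDomain R]
    [IsNoetherianRing R] [IsNoetherianRing Rᵐᵒᵖ]
    (hR : IsNCUFD R)
    (u : R) (hu0 : u ≠ 0) (hunit : ¬ IsUnit u) (hn : IsNormalElem u) :
    IsPrimeElem u ↔ ∀ a b : R, u = a * b → IsUnit a ∨ IsUnit b := by
  refine ⟨fun hu a b => hu.isUnit_or_isUnit, fun hirr => ?_⟩
  obtain ⟨s, hsu, hs⟩ := hR.exists_isPrimeProd_mem hn.isTwoSided_span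
    (by simpa [Ideal.span_singleton_eq_bot] using hu0)
  obtain ⟨r, hr⟩ := Ideal.mem_span_singleton'.1 hsu
  obtain ⟨p, hp, t, rfl⟩ := (hs.isUnit_or_exists_prime_dvd hr).resolve_left hunit
  refine hp.of_isUnit_mul ((hirr t p rfl).resolve_right fun hpu => hp.2.2.1 ?_) hn
  obtain ⟨c, hc⟩ := hpu.exists_left_inv
  exact ⟨c, hc.symm⟩
end

section
/- Let R be a noetherian K-algebra domain equipped with a rational action of a K-torus H of rank r by K-algebra automorphisms (encoded by a ℤʳ-grading of R as below). If R is an H-UFD, i.e., every nonzero H-prime ideal of R contains a homogeneous prime element, then R is a noncommutative unique factorization ring: every nonzero prime ideal of R contains a nonzero prime ideal generated by a normal element. -/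
section GradedDefs

variable {K : Type*} [Field K] {R : Type*} [Ring R] [Algebra K R] {r : ℕ}

/-- `tᵐ = t₁^{m₁} ⋯ t_r^{m_r}` for a torus element `t ∈ (Kˣ)ʳ` and a character
`m ∈ ℤʳ`. -/
def tpow (t : Fin r → Kˣ) (m : Fin r → ℤ) : Kˣ := ∏ i, t i ^ m i

/-- A homogeneous (`H`-stable) two-sided ideal for the `ℤʳ`-grading `𝒜`. -/
def IsHomogIdealSet (𝒜 : (Fin r → ℤ) → Submodule K R) [GradedAlgebra 𝒜]
    (S : Set R) : Prop :=
  IsIdealSet S ∧ ∀ a ∈ S, ∀ m : Fin r → ℤ, ((DirectSum.decompose 𝒜 a m : R) ∈ S)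

/-- An `H`-prime ideal for the torus action encoded by the grading `𝒜`:
a proper homogeneous ideal `P` with `I·J ⊆ P → I ⊆ P ∨ J ⊆ P` for all
homogeneous ideals `I`, `J`. -/
def IsHPrimeIdealSet (𝒜 : (Fin r → ℤ) → Submodule K R) [GradedAlgebra 𝒜]
    (S : Set R) : Prop :=
  IsHomogIdealSet 𝒜 S ∧ (1 : R) ∉ S ∧
    ∀ I J : Set R, IsHomogIdealSet 𝒜 I → IsHomogIdealSet 𝒜 J →
      (∀ a ∈ I, ∀ b ∈ J, a * b ∈ S) → I ⊆ S ∨ J ⊆ S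

/-- `R` is an `H`-UFD for the torus action encoded by the grading `𝒜`: every
nonzero `H`-prime ideal contains a homogeneous prime element. -/
def IsHUFDg (𝒜 : (Fin r → ℤ) → Submodule K R) [GradedAlgebra 𝒜] : Prop :=
  ∀ S : Set R, IsHPrimeIdealSet 𝒜 S → S ≠ {0} →
    ∃ p ∈ S, IsPrimeElem p ∧ ∃ m : Fin r → ℤ, p ∈ 𝒜 m

/-- `u` is `H`-normal for the torus action encoded by the grading `𝒜`:
there is `t ∈ (Kˣ)ʳ` with `u·b = tᵐ·b·u` for every homogeneous `b` of any
degree `m`. -/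
def IsHNormalg (𝒜 : (Fin r → ℤ) → Submodule K R) (u : R) : Prop :=
  ∃ t : Fin r → Kˣ, ∀ m : Fin r → ℤ, ∀ b ∈ 𝒜 m,
    u * b = ((tpow t m : Kˣ) : K) • (b * u)

/-- An `H`-prime element: a prime element which is homogeneous and `H`-normal. -/
def IsHPrimeElemg (𝒜 : (Fin r → ℤ) → Submodule K R) (p : R) : Prop :=
  IsPrimeElem p ∧ (∃ m : Fin r → ℤ, p ∈ 𝒜 m) ∧ IsHNormalg 𝒜 p

/-- `R` is a strong `H`-UFD for the torus action encoded by the grading `𝒜`: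
every nonzero `H`-prime ideal contains an `H`-prime element. -/
def IsStrongHUFDg (𝒜 : (Fin r → ℤ) → Submodule K R) [GradedAlgebra 𝒜] : Prop :=
  ∀ S : Set R, IsHPrimeIdealSet 𝒜 S → S ≠ {0} → ∃ p ∈ S, IsHPrimeElemg 𝒜 p

end GradedDefs


namespace HUFD

open GradedRing (proj)

section Normal

variable {R : Type*} [Ring R]

theorem IsNormalElem.exists_left {u : R} (hu : IsNormalElem u) (x : R) :
    ∃ y, u * x = y * u := by
  have : u * x ∈ {y : R | ∃ t : R, y = u * t} := ⟨x, rfl⟩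
  rw [hu] at this
  exact this

theorem IsNormalElem.exists_right {u : R} (hu : IsNormalElem u) (x : R) :
    ∃ y, x * u = u * y := by
  have : x * u ∈ {y : R | ∃ t : R, y = t * u} := ⟨x, rfl⟩
  rw [← hu] at this
  exact this

theorem isNormalElem_of {u : R} (h₁ : ∀ x, ∃ y, u * x = y * u)
    (h₂ : ∀ x, ∃ y, x * u = u * y) : IsNormalElem u := by
  ext y
  constructor
  · rintro ⟨t, rfl⟩; exact h₁ t
  · rintro ⟨t, rfl⟩; exact h₂ t

theorem isNormalElem_one : IsNormalElem (1 : R) := by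
  simp [IsNormalElem]

theorem IsNormalElem.mul {u v : R} (hu : IsNormalElem u) (hv : IsNormalElem v) :
    IsNormalElem (u * v) := by
  refine isNormalElem_of (fun x => ?_) (fun x => ?_)
  · obtain ⟨y, hy⟩ := IsNormalElem.exists_left hv x
    obtain ⟨w, hw⟩ := IsNormalElem.exists_left hu y
    exact ⟨w, by rw [mul_assoc, hy, ← mul_assoc, hw, mul_assoc]⟩
  · obtain ⟨y, hy⟩ := IsNormalElem.exists_right hu x
    obtain ⟨w, hw⟩ := IsNormalElem.exists_right hv y
    exact ⟨w, by rw [← mul_assoc, hy, mul_assoc, hw, mul_assoc]⟩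

/-- If a product `u * e` and its right factor `e` are normal in a domain, so is `u`. -/
theorem IsNormalElem.of_mul_right [IsDomain R] {u e : R} (he : IsNormalElem e) (he0 : e ≠ 0)
    (h : IsNormalElem (u * e)) : IsNormalElem u := by
  refine isNormalElem_of (fun x => ?_) (fun x => ?_)
  · obtain ⟨y, hy⟩ := IsNormalElem.exists_right he x
    obtain ⟨w, hw⟩ := IsNormalElem.exists_left h y
    refine ⟨w, mul_right_cancel₀ he0 ?_⟩
    rw [mul_assoc, hy, ← mul_assoc, hw, mul_assoc]
  · obtain ⟨y, hy⟩ := IsNormalElem.exists_right h x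
    obtain ⟨w, hw⟩ := IsNormalElem.exists_left he y
    refine ⟨w, mul_right_cancel₀ he0 ?_⟩
    rw [mul_assoc, hy, mul_assoc, hw, mul_assoc]

theorem IsIdealSet.neg_mem {S : Set R} (hS : IsIdealSet S) {a : R} (ha : a ∈ S) : -a ∈ S := by
  simpa using (hS.2.2 (-1) a ha).1

theorem IsIdealSet.sub_mem {S : Set R} (hS : IsIdealSet S) {a b : R} (ha : a ∈ S) (hb : b ∈ S) :
    a - b ∈ S := by
  rw [sub_eq_add_neg]
  exact hS.2.1 _ ha _ (IsIdealSet.neg_mem hS hb)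

theorem IsPrimeIdealSet.mem_or_mem_left {S : Set R} (hS : IsPrimeIdealSet S) {u v : R}
    (hu : IsNormalElem u) (h : u * v ∈ S) : u ∈ S ∨ v ∈ S := by
  refine hS.2.2 u v fun t => ?_
  obtain ⟨y, hy⟩ := IsNormalElem.exists_left hu t
  rw [hy, mul_assoc]
  exact (hS.1.2.2 y _ h).1

theorem IsPrimeIdealSet.mem_or_mem_right {S : Set R} (hS : IsPrimeIdealSet S) {u v : R}
    (hv : IsNormalElem v) (h : u * v ∈ S) : u ∈ S ∨ v ∈ S := by
  refine hS.2.2 u v fun t => ?_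
  obtain ⟨y, hy⟩ := IsNormalElem.exists_right hv t
  rw [mul_assoc, hy, ← mul_assoc]
  exact (hS.1.2.2 y _ h).2

theorem isIdealSet_multiples {u : R} (hu : IsNormalElem u) :
    IsIdealSet {y : R | ∃ t : R, y = t * u} := by
  refine ⟨⟨0, by simp⟩, ?_, ?_⟩
  · rintro _ ⟨s, rfl⟩ _ ⟨t, rfl⟩
    exact ⟨s + t, by rw [add_mul]⟩
  · rintro x _ ⟨s, rfl⟩
    refine ⟨⟨x * s, by rw [mul_assoc]⟩, ?_⟩
    obtain ⟨y, hy⟩ := IsNormalElem.exists_left hu x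
    exact ⟨s * y, by rw [mul_assoc, hy, mul_assoc]⟩

theorem IsPrimeElem.isPrimeIdealSet {p : R} (hp : IsPrimeElem p) :
    IsPrimeIdealSet {y : R | ∃ t : R, y = t * p} := by
  refine ⟨isIdealSet_multiples hp.2.1, hp.2.2.1, fun a b h => hp.2.2.2 a b ?_⟩
  have h1 := h 1
  rwa [mul_one] at h1

/-- `v` twists the elements of `R` in the same way as `c` does. -/
def Twist (c v : R) : Prop := ∀ b b' : R, c * b = b' * c → v * b = b' * v

end Normal

section Graded

variable {K : Type*} [Field K] {R : Type*} [Ring R] [Algebra K R] {r : ℕ}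
  (𝒜 : (Fin r → ℤ) → Submodule K R) [GradedAlgebra 𝒜]

theorem proj_left {i : Fin r → ℤ} {x : R} (hx : x ∈ 𝒜 i) (y : R) (n : Fin r → ℤ) :
    proj 𝒜 n (x * y) = x * proj 𝒜 (n - i) y := by
  have := DirectSum.coe_decompose_mul_add_of_left_mem 𝒜 (j := n - i) (b := y) hx
  rw [add_sub_cancel] at this
  simpa [GradedRing.proj_apply] using this

theorem proj_right {i : Fin r → ℤ} {y : R} (hy : y ∈ 𝒜 i) (x : R) (n : Fin r → ℤ) :
    proj 𝒜 n (x * y) = proj 𝒜 (n - i) x * y := by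
  have := DirectSum.coe_decompose_mul_add_of_right_mem 𝒜 (i := n - i) (a := x) hy
  rw [sub_add_cancel] at this
  simpa [GradedRing.proj_apply] using this

theorem proj_mem (n : Fin r → ℤ) (x : R) : proj 𝒜 n x ∈ 𝒜 n := by
  rw [GradedRing.proj_apply]; exact SetLike.coe_mem _

theorem proj_self {n : Fin r → ℤ} {x : R} (hx : x ∈ 𝒜 n) : proj 𝒜 n x = x := by
  rw [GradedRing.proj_apply, DirectSum.decompose_of_mem_same 𝒜 hx]

theorem proj_ne {n m : Fin r → ℤ} {x : R} (hx : x ∈ 𝒜 n) (h : n ≠ m) : proj 𝒜 m x = 0 := by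
  rw [GradedRing.proj_apply, DirectSum.decompose_of_mem_ne 𝒜 hx h]

theorem exists_sum_proj (x : R) :
    ∃ s : Finset (Fin r → ℤ), (∀ n ∉ s, proj 𝒜 n x = 0) ∧ ∑ n ∈ s, proj 𝒜 n x = x := by
  classical
  refine ⟨(DirectSum.decompose 𝒜 x).support, fun n hn => ?_,
    DirectSum.sum_support_decompose 𝒜 x⟩
  rw [GradedRing.proj_apply]
  simpa using hn

theorem eq_zero_of_proj {x : R} (h : ∀ n, proj 𝒜 n x = 0) : x = 0 := by
  obtain ⟨s, -, hs⟩ := exists_sum_proj 𝒜 x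
  rw [← hs]
  exact Finset.sum_eq_zero fun n _ => h n

/-- The submonoid generated by the homogeneous prime elements. -/
def primeMonoid : Submonoid R :=
  Submonoid.closure {p : R | IsPrimeElem p ∧ ∃ m, p ∈ 𝒜 m}

omit [GradedAlgebra 𝒜] in
theorem isNormalElem_of_mem_primeMonoid {c : R} (hc : c ∈ primeMonoid 𝒜) : IsNormalElem c := by
  induction hc using Submonoid.closure_induction with
  | mem x hx => exact hx.1.2.1
  | one => exact isNormalElem_one
  | mul x y _ _ hx hy => exact IsNormalElem.mul hx hy

omit [GradedAlgebra 𝒜] in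
theorem ne_zero_of_mem_primeMonoid [IsDomain R] {c : R} (hc : c ∈ primeMonoid 𝒜) : c ≠ 0 := by
  induction hc using Submonoid.closure_induction with
  | mem x hx => exact hx.1.1
  | one => exact one_ne_zero
  | mul x y _ _ hx hy => exact mul_ne_zero hx hy

theorem exists_degree_of_mem_primeMonoid {c : R} (hc : c ∈ primeMonoid 𝒜) :
    ∃ m, c ∈ 𝒜 m := by
  induction hc using Submonoid.closure_induction with
  | mem x hx => exact hx.2
  | one => exact ⟨0, SetLike.GradedOne.one_mem⟩
  | mul x y _ _ hx hy =>
    obtain ⟨m, hm⟩ := hx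
    obtain ⟨n, hn⟩ := hy
    exact ⟨m + n, SetLike.GradedMul.mul_mem hm hn⟩

omit [GradedAlgebra 𝒜] in
/-- A prime ideal meeting `primeMonoid` contains a homogeneous prime element. -/
theorem exists_prime_of_mem_primeMonoid {S : Set R} (hS : IsPrimeIdealSet S) {c : R}
    (hc : c ∈ primeMonoid 𝒜) (h : c ∈ S) : ∃ p ∈ S, IsPrimeElem p := by
  induction hc using Submonoid.closure_induction with
  | mem x hx => exact ⟨x, h, hx.1⟩
  | one => exact absurd h hS.2.1
  | mul x y hx hy ihx ihy =>
    rcases IsPrimeIdealSet.mem_or_mem_left hS (isNormalElem_of_mem_primeMonoid 𝒜 hx) h with h | h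
    · exact ihx h
    · exact ihy h

omit [GradedAlgebra 𝒜] in
/-- If no homogeneous prime divides the normal element `u`, then elements of `primeMonoid`
can be cancelled modulo `Ru`. -/
theorem nDvd_of_nDvd_mul [IsDomain R] {u : R} (hu : IsNormalElem u)
    (hp : ∀ p, IsPrimeElem p → (∃ m, p ∈ 𝒜 m) → ¬ NDvd p u) {c : R}
    (hc : c ∈ primeMonoid 𝒜) (x : R) (h : NDvd u (x * c)) : NDvd u x := by
  induction hc using Submonoid.closure_induction generalizing x with
  | mem p hpp =>
    obtain ⟨t, ht⟩ := h
    obtain ⟨t₂, ht₂⟩ := IsNormalElem.exists_right hu t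
    have h1 : NDvd p (u * t₂) := ⟨x, by rw [← ht₂, ht]⟩
    rcases hpp.1.2.2.2 _ _ h1 with h1 | ⟨s, hs⟩
    · exact absurd h1 (hp p hpp.1 hpp.2)
    · obtain ⟨y, hy⟩ := IsNormalElem.exists_left hu s
      refine ⟨y, mul_right_cancel₀ hpp.1.1 ?_⟩
      rw [ht, ht₂, hs, ← mul_assoc, hy]
  | one => simpa using h
  | mul a b _ _ iha ihb => exact iha x (ihb _ (by rwa [mul_assoc]))

/-- The left ideal underlying an ideal given as a set. -/
def toIdeal {S : Set R} (hS : IsIdealSet S) : Ideal R where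
  carrier := S
  add_mem' ha hb := hS.2.1 _ ha _ hb
  zero_mem' := hS.1
  smul_mem' x _ ha := (hS.2.2 x _ ha).1

theorem isHomogIdealSet_sup {I J : Ideal R} (hI : IsHomogIdealSet 𝒜 (I : Set R))
    (hJ : IsHomogIdealSet 𝒜 (J : Set R)) : IsHomogIdealSet 𝒜 ((I ⊔ J : Ideal R) : Set R) := by
  refine ⟨⟨Submodule.zero_mem _, fun a ha b hb => Submodule.add_mem _ ha hb, fun x a ha =>
    ⟨Submodule.smul_mem _ x ha, ?_⟩⟩, fun a ha m => ?_⟩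
  · obtain ⟨y, hy, z, hz, rfl⟩ := Submodule.mem_sup.1 ha
    rw [add_mul]
    exact Submodule.add_mem_sup (hI.1.2.2 x y hy).2 (hJ.1.2.2 x z hz).2
  · obtain ⟨y, hy, z, hz, rfl⟩ := Submodule.mem_sup.1 ha
    rw [DirectSum.decompose_add, DirectSum.add_apply, Submodule.coe_add]
    exact Submodule.add_mem_sup (hI.2 y hy m) (hJ.2 z hz m)

/-- In an `H`-UFD every nonzero homogeneous ideal contains a product of homogeneous primes. -/
theorem exists_mem_primeMonoid [IsNoetherianRing R] (hR : IsHUFDg 𝒜) {S : Set R}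
    (hS : IsHomogIdealSet 𝒜 S) (h0 : ∃ a ∈ S, a ≠ 0) : ∃ c ∈ primeMonoid 𝒜, c ∈ S := by
  suffices H : ∀ I : Ideal R, IsHomogIdealSet 𝒜 (I : Set R) → I ≠ ⊥ →
      ∃ c ∈ primeMonoid 𝒜, c ∈ I by
    refine H (toIdeal hS.1) hS fun h => ?_
    obtain ⟨a, ha, ha0⟩ := h0
    exact ha0 (by simpa [h] using (show a ∈ toIdeal hS.1 from ha))
  intro I
  induction I using IsNoetherian.induction with
  | hgt I ih =>
    intro hI hI0
    by_cases h1 : (1 : R) ∈ I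
    · exact ⟨1, Submonoid.one_mem _, h1⟩
    by_cases hP : IsHPrimeIdealSet 𝒜 (I : Set R)
    · obtain ⟨p, hp, hpp, hm⟩ := hR _ hP fun h => hI0 (by
        apply SetLike.coe_injective; simpa using h)
      exact ⟨p, Submonoid.subset_closure ⟨hpp, hm⟩, hp⟩
    · simp only [IsHPrimeIdealSet, not_and, not_forall, not_or] at hP
      obtain ⟨A, B, hA, hB, hAB, hAI, hBI⟩ := hP hI h1
      have key : ∀ {A : Set R} (hA : IsHomogIdealSet 𝒜 A), ¬ A ⊆ I →
          ∃ c ∈ primeMonoid 𝒜, c ∈ I ⊔ toIdeal hA.1 := by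
        intro A hA hAI
        have hlt : I < I ⊔ toIdeal hA.1 := by
          rw [left_lt_sup]
          exact fun h => hAI h
        exact ih _ hlt (isHomogIdealSet_sup 𝒜 hI hA) (bot_lt_iff_ne_bot.1 (bot_le.trans_lt hlt))
      obtain ⟨c, hc, hcA⟩ := key hA hAI
      obtain ⟨d, hd, hdB⟩ := key hB hBI
      refine ⟨c * d, Submonoid.mul_mem _ hc hd, ?_⟩
      obtain ⟨x, hx, a, ha, rfl⟩ := Submodule.mem_sup.1 hcA
      obtain ⟨y, hy, b, hb, rfl⟩ := Submodule.mem_sup.1 hdB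
      have e : (x + a) * (y + b) = x * (y + b) + (a * y + a * b) := by noncomm_ring
      rw [e]
      exact I.add_mem (hI.1.2.2 _ x hx).2 (I.add_mem (hI.1.2.2 _ y hy).1 (hAB a ha b hb))

/-- The nonzero components of `a` have degrees in the translate `E + g`. -/
def SuppIn (E : Finset (Fin r → ℤ)) (g : Fin r → ℤ) (a : R) : Prop :=
  ∀ n, n - g ∉ E → proj 𝒜 n a = 0

theorem twist_of_homogeneous [IsDomain R] {c v : R} {m : Fin r → ℤ} (hc : c ∈ 𝒜 m)
    (hcn : IsNormalElem c) (hc0 : c ≠ 0)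
    (h : ∀ j, ∀ b ∈ 𝒜 j, ∀ b' ∈ 𝒜 j, c * b = b' * c → v * b = b' * v) : Twist c v := by
  intro b
  induction b using DirectSum.Decomposition.inductionOn 𝒜 with
  | zero =>
    intro b' hb
    have : b' = 0 := by simpa [hc0] using hb.symm
    simp [this]
  | @homogeneous j b =>
    intro b' hb
    have h1 : c * (b : R) = proj 𝒜 j b' * c := by
      have := congrArg (proj 𝒜 (m + j)) hb
      rwa [proj_left 𝒜 hc, proj_right 𝒜 hc, add_sub_cancel_left, proj_self 𝒜 b.2] at this
    have h2 : b' = proj 𝒜 j b' := mul_right_cancel₀ hc0 (hb.symm.trans h1)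
    rw [h2]
    exact h j b b.2 _ (proj_mem 𝒜 _ _) h1
  | add b₁ b₂ ih₁ ih₂ =>
    intro b' hb
    obtain ⟨y₁, hy₁⟩ := IsNormalElem.exists_left hcn b₁
    obtain ⟨y₂, hy₂⟩ := IsNormalElem.exists_left hcn b₂
    have : b' = y₁ + y₂ := mul_right_cancel₀ hc0 (by rw [← hb, mul_add, hy₁, hy₂, add_mul])
    rw [this, mul_add, add_mul, ih₁ _ hy₁, ih₂ _ hy₂]

theorem Twist.proj [IsDomain R] {c v : R} {m : Fin r → ℤ} (hc : c ∈ 𝒜 m)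
    (hcn : IsNormalElem c) (hc0 : c ≠ 0) (h : Twist c v) (n : Fin r → ℤ) :
    Twist c (proj 𝒜 n v) := by
  refine twist_of_homogeneous 𝒜 hc hcn hc0 fun j b hb b' hb' e => ?_
  have := congrArg (GradedRing.proj 𝒜 (n + j)) (h b b' e)
  rwa [proj_left 𝒜 hb', proj_right 𝒜 hb, add_sub_cancel_right] at this

/-- The degree `l` components of elements of an ideal `I` with support in `E + (l - e)` span a
homogeneous ideal. -/
theorem isHomogIdealSet_components {I : Set R} (hI : IsIdealSet I) (E : Finset (Fin r → ℤ))
    (e : Fin r → ℤ) :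
    IsHomogIdealSet 𝒜 {y : R | ∀ l, ∃ v ∈ I, SuppIn 𝒜 E (l - e) v ∧ proj 𝒜 l v = proj 𝒜 l y} := by
  set J := {y : R | ∀ l, ∃ v ∈ I, SuppIn 𝒜 E (l - e) v ∧ proj 𝒜 l v = proj 𝒜 l y} with hJ
  have hzero : (0 : R) ∈ J := fun l => ⟨0, hI.1, fun n _ => by simp, rfl⟩
  have hadd : ∀ a ∈ J, ∀ b ∈ J, a + b ∈ J := by
    intro a ha b hb l
    obtain ⟨v, hv, hvs, hve⟩ := ha l
    obtain ⟨w, hw, hws, hwe⟩ := hb l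
    exact ⟨v + w, hI.2.1 _ hv _ hw, fun n hn => by rw [map_add, hvs n hn, hws n hn, add_zero],
      by rw [map_add, map_add, hve, hwe]⟩
  refine ⟨⟨hzero, hadd, fun x a ha => ⟨?_, ?_⟩⟩, fun a ha m l => ?_⟩
  · induction x using DirectSum.Decomposition.inductionOn 𝒜 with
    | zero => simpa using hzero
    | @homogeneous j b =>
      intro l
      obtain ⟨v, hv, hvs, hve⟩ := ha (l - j)
      refine ⟨b * v, (hI.2.2 _ _ hv).1, fun n hn => ?_, ?_⟩
      · rw [proj_left 𝒜 b.2, hvs, mul_zero]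
        convert hn using 2
        abel
      · rw [proj_left 𝒜 b.2, hve, proj_left 𝒜 b.2]
    | add x y hx hy => rw [add_mul]; exact hadd _ hx _ hy
  · induction x using DirectSum.Decomposition.inductionOn 𝒜 with
    | zero => simpa using hzero
    | @homogeneous j b =>
      intro l
      obtain ⟨v, hv, hvs, hve⟩ := ha (l - j)
      refine ⟨v * b, (hI.2.2 _ _ hv).2, fun n hn => ?_, ?_⟩
      · rw [proj_right 𝒜 b.2, hvs, zero_mul]
        convert hn using 2
        abel
      · rw [proj_right 𝒜 b.2, hve, proj_right 𝒜 b.2]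
    | add x y hx hy => rw [mul_add]; exact hadd _ hx _ hy
  · rw [← GradedRing.proj_apply 𝒜 m a]
    by_cases hlm : m = l
    · subst hlm
      rw [proj_self 𝒜 (proj_mem 𝒜 m a)]
      exact ha m
    · exact ⟨0, hI.1, fun n _ => by simp, by rw [proj_ne 𝒜 (proj_mem 𝒜 m a) hlm, map_zero]⟩

/-- Every nonzero ideal of an `H`-UFD contains an element twisting `R` like a product `c` of
homogeneous primes, and having `c` as one of its components. -/
theorem exists_twist_mem [IsDomain R] [IsNoetherianRing R] (hR : IsHUFDg 𝒜) {I : Set R}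
    (hI : IsIdealSet I) {a : R} (ha : a ∈ I) (ha0 : a ≠ 0) {E₀ : Finset (Fin r → ℤ)}
    {g₀ : Fin r → ℤ} (haE : SuppIn 𝒜 E₀ g₀ a) :
    ∃ v ∈ I, ∃ c ∈ primeMonoid 𝒜, ∃ m, c ∈ 𝒜 m ∧ ∃ e ∈ E₀, SuppIn 𝒜 E₀ (m - e) v ∧
      proj 𝒜 m v = c ∧ Twist c v := by
  classical
  induction E₀ using Finset.strongInduction generalizing a g₀ with
  | H E ih =>
    by_cases hmin : ∃ E' ⊂ E, ∃ g, ∃ a' ∈ I, a' ≠ 0 ∧ SuppIn 𝒜 E' g a'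
    · obtain ⟨E', hE', g, a', ha', ha'0, hs⟩ := hmin
      obtain ⟨v, hv, c, hc, m, hm, e, he, h1, h2⟩ := ih E' hE' ha' ha'0 hs
      exact ⟨v, hv, c, hc, m, hm, e, hE'.1 he, fun n hn => h1 n fun h => hn (hE'.1 h), h2⟩
    push Not at hmin
    obtain ⟨n, hn⟩ : ∃ n, proj 𝒜 n a ≠ 0 := by
      by_contra! h
      exact ha0 (eq_zero_of_proj 𝒜 h)
    obtain ⟨e, he, rfl⟩ : ∃ e ∈ E, n = e + g₀ :=
      ⟨n - g₀, by by_contra h; exact hn (haE n h), by simp⟩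
    obtain ⟨c, hc, hcJ⟩ := exists_mem_primeMonoid 𝒜 hR (isHomogIdealSet_components 𝒜 hI E e)
      ⟨proj 𝒜 (e + g₀) a, fun l => by
        by_cases hl : e + g₀ = l
        · subst hl
          exact ⟨a, ha, by simpa using haE, by rw [proj_self 𝒜 (proj_mem 𝒜 _ a)]⟩
        · exact ⟨0, hI.1, fun n _ => by simp,
            by rw [proj_ne 𝒜 (proj_mem 𝒜 _ a) hl, map_zero]⟩, hn⟩
    obtain ⟨m, hm⟩ := exists_degree_of_mem_primeMonoid 𝒜 hc
    obtain ⟨v, hv, hvs, hve⟩ := hcJ m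
    rw [proj_self 𝒜 hm] at hve
    refine ⟨v, hv, c, hc, m, hm, e, he, hvs, hve, twist_of_homogeneous 𝒜 hm
      (isNormalElem_of_mem_primeMonoid 𝒜 hc) (ne_zero_of_mem_primeMonoid 𝒜 hc)
      fun j b hb b' hb' hbb => ?_⟩
    by_contra hne
    refine hmin (E.erase e) (Finset.erase_ssubset he) (m + j - e) (v * b - b' * v)
      (IsIdealSet.sub_mem hI (hI.2.2 _ _ hv).2 (hI.2.2 _ _ hv).1) (sub_ne_zero.2 hne) ?_
    intro n hn
    rw [map_sub, proj_right 𝒜 hb, proj_left 𝒜 hb']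
    by_cases hnE : n - (m + j - e) ∈ E
    · have : n - (m + j - e) = e := by
        by_contra h
        exact hn (Finset.mem_erase.2 ⟨h, hnE⟩)
      have h3 : n - j = m := by
        have h4 : n = e + (m + j - e) := by rw [← sub_eq_iff_eq_add]; exact this
        rw [h4]; abel
      rw [h3, hve, hbb, sub_self]
    · rw [hvs, zero_mul, mul_zero, sub_zero]
      convert hnE using 2
      abel

/-- Twisting elements detect inclusion of an ideal in `Ru`. -/
theorem subset_of_twist_mem [IsDomain R] [IsNoetherianRing R] (hR : IsHUFDg 𝒜) {I : Set R}
    (hI : IsIdealSet I) {u : R} (hu : IsNormalElem u)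
    (hp : ∀ p, IsPrimeElem p → (∃ m, p ∈ 𝒜 m) → ¬ NDvd p u)
    (h : ∀ v ∈ I, ∀ c ∈ primeMonoid 𝒜, Twist c v → NDvd u v) {a : R} (ha : a ∈ I) :
    NDvd u a := by
  classical
  obtain ⟨s, hs, -⟩ := exists_sum_proj 𝒜 a
  have hsa : SuppIn 𝒜 s 0 a := fun n hn => hs n (by simpa using hn)
  generalize (0 : Fin r → ℤ) = g at hsa
  clear hs
  induction s using Finset.strongInduction generalizing a g with
  | H E ih =>
    by_cases ha0 : a = 0
    · exact ⟨0, by simp [ha0]⟩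
    obtain ⟨v, hv, c, hc, m, hm, e, he, hvs, hve, htw⟩ := exists_twist_mem 𝒜 hR hI ha ha0 hsa
    obtain ⟨y, hy⟩ := IsNormalElem.exists_right (isNormalElem_of_mem_primeMonoid 𝒜 hc)
      (proj 𝒜 (g + e) a)
    have hy' : proj 𝒜 (g + e) a * c = c * proj 𝒜 (g + e) y := by
      have := congrArg (proj 𝒜 (g + e + m)) hy
      rwa [proj_left 𝒜 hm, proj_right 𝒜 hm, add_sub_cancel_right,
        proj_self 𝒜 (proj_mem 𝒜 _ _)] at this
    have hyd := proj_mem 𝒜 (g + e) y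
    set x := proj 𝒜 (g + e) y
    refine nDvd_of_nDvd_mul 𝒜 hu hp hc a ?_
    have hv' := h v hv c hc htw
    have hdiff : NDvd u (a * c - v * x) := by
      refine ih (E.erase e) (Finset.erase_ssubset he)
        (IsIdealSet.sub_mem hI (hI.2.2 _ _ ha).2 (hI.2.2 _ _ hv).2) (g + m) fun n hn => ?_
      rw [map_sub, proj_right 𝒜 hm, proj_right 𝒜 hyd]
      by_cases hnE : n - (g + m) ∈ E
      · have h5 : n - (g + m) = e := by
          by_contra h
          exact hn (Finset.mem_erase.2 ⟨h, hnE⟩)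
        have h4 : n = e + (g + m) := by rw [← sub_eq_iff_eq_add]; exact h5
        have h6 : n - m = g + e := by rw [h4]; abel
        have h7 : n - (g + e) = m := by rw [h4]; abel
        rw [h6, h7, hve, hy', sub_self]
      · rw [hvs, hsa, zero_mul, zero_mul, sub_zero]
        · convert hnE using 2; abel
        · convert hnE using 2; abel
    have hI' := isIdealSet_multiples hu
    have h3 := hI'.2.1 _ hdiff _ (hI'.2.2 x v hv').2
    rwa [sub_add_cancel] at h3

end Graded

section Fractions

variable {K : Type*} [Field K] {R : Type*} [Ring R] [Algebra K R] {r : ℕ}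
  (𝒜 : (Fin r → ℤ) → Submodule K R)
  {D F : Type*} [Ring D] [Field F] [Algebra F D] (ι : R →+* D)

/-- The scalar `z` is a fraction over `R` with denominator a product of homogeneous primes. -/
def IsFrac (z : F) : Prop := ∃ c ∈ primeMonoid 𝒜, ∃ u, z • ι c = ι u

/-- The scalar `z` is a homogeneous fraction of degree `n`. -/
def HomFrac (n : Fin r → ℤ) (z : F) : Prop :=
  ∃ c ∈ primeMonoid 𝒜, ∃ m, c ∈ 𝒜 m ∧ ∃ u ∈ 𝒜 (n + m), z • ι c = ι u

variable {𝒜 ι}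

theorem HomFrac.isFrac {n : Fin r → ℤ} {z : F} (h : HomFrac 𝒜 ι n z) : IsFrac 𝒜 ι z := by
  obtain ⟨c, hc, -, -, u, -, h⟩ := h
  exact ⟨c, hc, u, h⟩

theorem add_smul_map_mul {z w : F} {c u d v : R} (h : z • ι c = ι u) (h' : w • ι d = ι v) :
    (z + w) • ι (c * d) = ι (u * d + c * v) := by
  rw [add_smul, map_mul, ← smul_mul_assoc, ← mul_smul_comm, h, h', map_add, map_mul, map_mul]

theorem mul_smul_map_mul {z w : F} {c u d v : R} (h : z • ι c = ι u) (h' : w • ι d = ι v) :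
    (z * w) • ι (c * d) = ι (u * v) := by
  rw [map_mul, ← smul_mul_smul_comm, h, h', map_mul]

theorem IsFrac.add {z w : F} (hz : IsFrac 𝒜 ι z) (hw : IsFrac 𝒜 ι w) : IsFrac 𝒜 ι (z + w) := by
  obtain ⟨c, hc, u, h⟩ := hz
  obtain ⟨d, hd, v, h'⟩ := hw
  exact ⟨c * d, mul_mem hc hd, _, add_smul_map_mul h h'⟩

theorem IsFrac.mul {z w : F} (hz : IsFrac 𝒜 ι z) (hw : IsFrac 𝒜 ι w) : IsFrac 𝒜 ι (z * w) := by
  obtain ⟨c, hc, u, h⟩ := hz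
  obtain ⟨d, hd, v, h'⟩ := hw
  exact ⟨c * d, mul_mem hc hd, _, mul_smul_map_mul h h'⟩

theorem isNormalElem_of_smul_eq (hι : Function.Injective ι) {z : F} {c u : R}
    (hc : IsNormalElem c) (h : z • ι c = ι u) : IsNormalElem u := by
  refine isNormalElem_of (fun x => ?_) (fun x => ?_)
  · obtain ⟨y, hy⟩ := IsNormalElem.exists_left hc x
    refine ⟨y, hι ?_⟩
    rw [map_mul, map_mul, ← h, smul_mul_assoc, ← map_mul, hy, map_mul, mul_smul_comm]
  · obtain ⟨y, hy⟩ := IsNormalElem.exists_right hc x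
    refine ⟨y, hι ?_⟩
    rw [map_mul, map_mul, ← h, mul_smul_comm, ← map_mul, hy, map_mul, smul_mul_assoc]

theorem twist_of_smul_eq (hι : Function.Injective ι) {z : F} {c u : R}
    (h : z • ι c = ι u) : Twist c u := by
  intro b b' hb
  apply hι
  rw [map_mul, map_mul, ← h, smul_mul_assoc, ← map_mul, hb, map_mul, mul_smul_comm]

theorem eq_zero_of_smul_eq_zero [IsDomain R] (hι : Function.Injective ι) {z : F} {c : R}
    (hc : c ≠ 0) (h : z • ι c = 0) : z = 0 := by
  rcases smul_eq_zero.1 h with h | h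
  · exact h
  · exact absurd ((map_eq_zero_iff ι hι).1 h) hc

variable [GradedAlgebra 𝒜]

theorem HomFrac.zero (n : Fin r → ℤ) : HomFrac 𝒜 ι n (0 : F) :=
  ⟨1, one_mem _, 0, SetLike.GradedOne.one_mem, 0, zero_mem _, by simp⟩

theorem HomFrac.one : HomFrac 𝒜 ι 0 (1 : F) :=
  ⟨1, one_mem _, 0, SetLike.GradedOne.one_mem, 1, by
    simpa using (SetLike.GradedOne.one_mem : (1 : R) ∈ 𝒜 0), by simp⟩

theorem HomFrac.add {n : Fin r → ℤ} {z w : F} (hz : HomFrac 𝒜 ι n z) (hw : HomFrac 𝒜 ι n w) :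
    HomFrac 𝒜 ι n (z + w) := by
  obtain ⟨c, hc, m, hm, u, hu, h⟩ := hz
  obtain ⟨d, hd, l, hl, v, hv, h'⟩ := hw
  refine ⟨c * d, mul_mem hc hd, m + l, SetLike.GradedMul.mul_mem hm hl, u * d + c * v,
    add_mem ?_ ?_, add_smul_map_mul h h'⟩
  · rw [← add_assoc]; exact SetLike.GradedMul.mul_mem hu hl
  · rw [add_left_comm]; exact SetLike.GradedMul.mul_mem hm hv

omit [GradedAlgebra 𝒜] in
theorem HomFrac.neg {n : Fin r → ℤ} {z : F} (hz : HomFrac 𝒜 ι n z) : HomFrac 𝒜 ι n (-z) := by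
  obtain ⟨c, hc, m, hm, u, hu, h⟩ := hz
  exact ⟨c, hc, m, hm, -u, neg_mem hu, by rw [neg_smul, h, map_neg]⟩

theorem HomFrac.mul {n n' : Fin r → ℤ} {z w : F} (hz : HomFrac 𝒜 ι n z)
    (hw : HomFrac 𝒜 ι n' w) : HomFrac 𝒜 ι (n + n') (z * w) := by
  obtain ⟨c, hc, m, hm, u, hu, h⟩ := hz
  obtain ⟨d, hd, l, hl, v, hv, h'⟩ := hw
  refine ⟨c * d, mul_mem hc hd, m + l, SetLike.GradedMul.mul_mem hm hl, u * v, ?_,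
    mul_smul_map_mul h h'⟩
  rw [add_add_add_comm]
  exact SetLike.GradedMul.mul_mem hu hv

theorem HomFrac.inv [IsDomain R] [IsNoetherianRing R] (hR : IsHUFDg 𝒜)
    (hι : Function.Injective ι) {n : Fin r → ℤ} {z : F} (hz : HomFrac 𝒜 ι n z) :
    HomFrac 𝒜 ι (-n) z⁻¹ := by
  by_cases hz0 : z = 0
  · rw [hz0, inv_zero]; exact HomFrac.zero _
  obtain ⟨c, hc, m, hm, u, hu, h⟩ := hz
  have hun := isNormalElem_of_smul_eq hι (isNormalElem_of_mem_primeMonoid 𝒜 hc) h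
  have hu0 : u ≠ 0 := by
    rintro rfl
    rw [map_zero] at h
    exact hz0 (eq_zero_of_smul_eq_zero hι (ne_zero_of_mem_primeMonoid 𝒜 hc) h)
  have hhom : IsHomogIdealSet 𝒜 {y : R | ∃ t : R, y = t * u} := by
    refine ⟨isIdealSet_multiples hun, ?_⟩
    rintro _ ⟨t, rfl⟩ l
    rw [← GradedRing.proj_apply]
    exact ⟨_, proj_right 𝒜 hu t l⟩
  obtain ⟨d, hd, v, hv⟩ := exists_mem_primeMonoid 𝒜 hR hhom ⟨u, ⟨1, by simp⟩, hu0⟩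
  obtain ⟨l, hl⟩ := exists_degree_of_mem_primeMonoid 𝒜 hd
  have hv' := congrArg (proj 𝒜 l) hv
  rw [proj_self 𝒜 hl, proj_right 𝒜 hu] at hv'
  refine ⟨d, hd, l, hl, proj 𝒜 (l - (n + m)) v * c, ?_, ?_⟩
  · have := SetLike.GradedMul.mul_mem (proj_mem 𝒜 (l - (n + m)) v) hm
    convert this using 2
    abel
  · rw [hv', map_mul, ← h, mul_smul_comm, smul_smul, inv_mul_cancel₀ hz0, one_smul, map_mul]

theorem HomFrac.pow {n : Fin r → ℤ} {z : F} (hz : HomFrac 𝒜 ι n z) (j : ℕ) :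
    HomFrac 𝒜 ι (j • n) (z ^ j) := by
  induction j with
  | zero => simpa using HomFrac.one
  | succ j ih => rw [pow_succ, succ_nsmul]; exact HomFrac.mul ih hz

theorem HomFrac.zpow [IsDomain R] [IsNoetherianRing R] (hR : IsHUFDg 𝒜)
    (hι : Function.Injective ι) {n : Fin r → ℤ} {z : F} (hz : HomFrac 𝒜 ι n z) (j : ℤ) :
    HomFrac 𝒜 ι (j • n) (z ^ j) := by
  cases j with
  | ofNat j => simpa using HomFrac.pow hz j
  | negSucc j =>
    rw [zpow_negSucc, negSucc_zsmul]
    exact HomFrac.inv hR hι (HomFrac.pow hz _)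

theorem HomFrac.prod {κ : Type*} (s : Finset κ) {n : κ → Fin r → ℤ} {z : κ → F}
    (h : ∀ i, HomFrac 𝒜 ι (n i) (z i)) : HomFrac 𝒜 ι (∑ i ∈ s, n i) (∏ i ∈ s, z i) := by
  classical
  induction s using Finset.induction_on with
  | empty => simpa using HomFrac.one
  | insert a s ha ih =>
    rw [Finset.sum_insert ha, Finset.prod_insert ha]
    exact HomFrac.mul (h a) ih

variable (𝒜 ι) in
/-- The field of homogeneous fractions of degree zero. -/
def zeroSubfield [IsDomain R] [IsNoetherianRing R] (hR : IsHUFDg 𝒜)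
    (hι : Function.Injective ι) : Subfield F where
  carrier := {z | HomFrac 𝒜 ι 0 z}
  mul_mem' ha hb := by simpa using HomFrac.mul ha hb
  one_mem' := HomFrac.one
  add_mem' ha hb := HomFrac.add ha hb
  zero_mem' := HomFrac.zero 0
  neg_mem' ha := HomFrac.neg ha
  inv_mem' a ha := by simpa using HomFrac.inv hR hι ha

variable (𝒜 ι F) in
/-- The group of degrees of nonzero homogeneous fractions. -/
def degreeSubmodule [IsDomain R] [IsNoetherianRing R] (hR : IsHUFDg 𝒜)
    (hι : Function.Injective ι) : Submodule ℤ (Fin r → ℤ) where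
  carrier := {n | ∃ z : F, z ≠ 0 ∧ HomFrac 𝒜 ι n z}
  add_mem' := by
    rintro _ _ ⟨z, hz, h⟩ ⟨w, hw, h'⟩
    exact ⟨z * w, mul_ne_zero hz hw, HomFrac.mul h h'⟩
  zero_mem' := ⟨1, one_ne_zero, HomFrac.one⟩
  smul_mem' := by
    rintro j _ ⟨z, hz, h⟩
    exact ⟨z ^ j, zpow_ne_zero j hz, HomFrac.zpow hR hι h j⟩

/-- Fractions decompose as sums of homogeneous fractions. -/
theorem IsFrac.exists_sum [IsDomain R] (hι : Function.Injective ι)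
    (hF : ∀ c v : R, c ≠ 0 → IsNormalElem c → Twist c v → ∃ z : F, z • ι c = ι v)
    {z : F} (hz : IsFrac 𝒜 ι z) :
    ∃ (s : Finset (Fin r → ℤ)) (w : (Fin r → ℤ) → F), (∃ m, ∀ n, HomFrac 𝒜 ι (n - m) (w n)) ∧
      ∑ n ∈ s, w n = z := by
  obtain ⟨c, hc, u, h⟩ := hz
  obtain ⟨m, hm⟩ := exists_degree_of_mem_primeMonoid 𝒜 hc
  have hc0 := ne_zero_of_mem_primeMonoid 𝒜 hc
  have hcn := isNormalElem_of_mem_primeMonoid 𝒜 hc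
  have htw := twist_of_smul_eq hι h
  choose w hw using fun n => hF c _ hc0 hcn (Twist.proj 𝒜 hm hcn hc0 htw n)
  obtain ⟨s, -, hs⟩ := exists_sum_proj 𝒜 u
  refine ⟨s, w, ⟨m, fun n => ⟨c, hc, m, hm, proj 𝒜 n u, ?_, hw n⟩⟩, ?_⟩
  · rw [sub_add_cancel]; exact proj_mem 𝒜 _ _
  · rw [← sub_eq_zero]
    refine eq_zero_of_smul_eq_zero hι hc0 ?_
    rw [sub_smul, Finset.sum_smul, h, Finset.sum_congr rfl fun n _ => hw n, ← map_sum, hs,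
      sub_self]

/-- Homogeneous fractions of distinct degrees are independent. -/
theorem HomFrac.eq_zero_of_sum [IsDomain R] (hι : Function.Injective ι) {κ : Type*}
    (s : Finset κ) {d : κ → Fin r → ℤ} (hd : Function.Injective d) {z : κ → F}
    (h : ∀ i, HomFrac 𝒜 ι (d i) (z i)) (h0 : ∑ i ∈ s, z i = 0) : ∀ i ∈ s, z i = 0 := by
  classical
  have key : ∃ c ∈ primeMonoid 𝒜, ∃ m, c ∈ 𝒜 m ∧ ∀ i ∈ s, ∃ u ∈ 𝒜 (d i + m), z i • ι c = ι u := by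
    clear h0
    induction s using Finset.induction_on with
    | empty => exact ⟨1, one_mem _, 0, SetLike.GradedOne.one_mem, by simp⟩
    | insert a s ha ih =>
      obtain ⟨c, hc, m, hm, hs⟩ := ih
      obtain ⟨c', hc', m', hm', u', hu', e'⟩ := h a
      refine ⟨c * c', mul_mem hc hc', m + m', SetLike.GradedMul.mul_mem hm hm', fun i hi => ?_⟩
      rcases Finset.mem_insert.1 hi with rfl | hi
      · refine ⟨c * u', ?_, ?_⟩
        · rw [add_left_comm]; exact SetLike.GradedMul.mul_mem hm hu'
        · rw [map_mul, ← mul_smul_comm, e', map_mul]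
      · obtain ⟨u, hu, e⟩ := hs i hi
        refine ⟨u * c', ?_, ?_⟩
        · rw [← add_assoc]; exact SetLike.GradedMul.mul_mem hu hm'
        · rw [map_mul, ← smul_mul_assoc, e, map_mul]
  obtain ⟨c, hc, m, hm, hs⟩ := key
  choose! u hu e using hs
  have hsum : ∑ i ∈ s, u i = 0 := by
    apply hι
    rw [map_sum, ← Finset.sum_congr rfl e, ← Finset.sum_smul, h0, zero_smul, map_zero]
  intro i hi
  have hui : u i = 0 := by
    have := congrArg (proj 𝒜 (d i + m)) hsum
    rw [map_sum, map_zero, Finset.sum_eq_single_of_mem i hi, proj_self 𝒜 (hu i hi)] at this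
    · exact this
    · intro j hj hji
      exact proj_ne 𝒜 (hu j hj) fun hh => hji (hd (add_right_cancel hh))
  refine eq_zero_of_smul_eq_zero hι (ne_zero_of_mem_primeMonoid 𝒜 hc) ?_
  rw [e i hi, hui, map_zero]

/-- The central fractions are, up to invertible monomials, a polynomial ring over a field. -/
theorem exists_mvPolynomial [IsDomain R] [IsNoetherianRing R] (hR : IsHUFDg 𝒜)
    (hι : Function.Injective ι)
    (hF : ∀ c v : R, c ≠ 0 → IsNormalElem c → Twist c v → ∃ z : F, z • ι c = ι v) :
    ∃ (k : Subfield F) (κ : Type) (φ : MvPolynomial κ k →+* F) (M : Submonoid (MvPolynomial κ k)),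
      Function.Injective φ ∧ (∀ f, IsFrac 𝒜 ι (φ f)) ∧ (∀ f ∈ M, f ≠ 0 ∧ IsFrac 𝒜 ι (φ f)⁻¹) ∧
      ∀ z, IsFrac 𝒜 ι z → ∃ g ∈ M, ∃ f, z * φ g = φ f := by
  classical
  let b := Module.Free.chooseBasis ℤ (degreeSubmodule 𝒜 F ι hR hι)
  let k := zeroSubfield (F := F) 𝒜 ι hR hι
  choose x hx0 hx using fun i => (b i).2
  let φ := (MvPolynomial.aeval x : MvPolynomial _ k →ₐ[k] F)
  let deg : (_ →₀ ℕ) → Fin r → ℤ := fun α => b.equivFun.symm fun i => (α i : ℤ)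
  have hterm : ∀ (α) (a : k), HomFrac 𝒜 ι (deg α) ((a : F) * ∏ i, x i ^ α i) := by
    intro α a
    have := HomFrac.mul a.2 (HomFrac.prod Finset.univ fun i => HomFrac.pow (hx i) (α i))
    convert this using 1
    simp [deg, Module.Basis.equivFun_symm_apply]
  have hφ : ∀ f : MvPolynomial _ k,
      φ f = ∑ α ∈ f.support, ((f.coeff α : k) : F) * ∏ i, x i ^ α i := fun f => by
    simp only [φ, MvPolynomial.aeval_def, MvPolynomial.eval₂_eq']
    rfl
  have hφX : ∀ i, φ (MvPolynomial.X i) = x i := fun i => MvPolynomial.aeval_X x i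
  have hφC : ∀ a : k, φ (MvPolynomial.C a) = (a : F) := fun a => MvPolynomial.aeval_C x a
  have hdeg : Function.Injective deg := by
    intro α β h
    have h1 := b.equivFun.symm.injective (Subtype.ext h)
    ext i
    exact_mod_cast congrFun h1 i
  refine ⟨k, _, φ.toRingHom, Submonoid.closure (Set.range MvPolynomial.X), ?_, fun f => ?_,
    fun f hf => ?_, fun z hz => ?_⟩
  · rw [injective_iff_map_eq_zero]
    intro f hf
    have hf' : φ f = 0 := hf
    rw [hφ] at hf'
    have := HomFrac.eq_zero_of_sum hι f.support hdeg (fun α => hterm α (f.coeff α)) hf'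
    ext α
    by_cases hα : α ∈ f.support
    · have h1 := this α hα
      rw [mul_eq_zero, Finset.prod_eq_zero_iff] at h1
      rcases h1 with h1 | ⟨i, -, h1⟩
      · simpa using h1
      · exact absurd h1 (pow_ne_zero _ (hx0 i))
    · simpa using hα
  · change IsFrac 𝒜 ι (φ f)
    induction f using MvPolynomial.induction_on with
    | C a => rw [hφC]; exact HomFrac.isFrac a.2
    | add f g hf hg => rw [map_add]; exact IsFrac.add hf hg
    | mul_X f i hf => rw [map_mul, hφX]; exact IsFrac.mul hf (HomFrac.isFrac (hx i))
  · change f ≠ 0 ∧ IsFrac 𝒜 ι (φ f)⁻¹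
    induction hf using Submonoid.closure_induction with
    | mem f hf =>
      obtain ⟨i, rfl⟩ := hf
      rw [hφX]
      exact ⟨MvPolynomial.X_ne_zero i, HomFrac.isFrac (HomFrac.inv hR hι (hx i))⟩
    | one =>
      rw [map_one, inv_one]
      exact ⟨one_ne_zero, HomFrac.isFrac HomFrac.one⟩
    | mul f g _ _ hf hg =>
      rw [map_mul, mul_inv]
      exact ⟨mul_ne_zero hf.1 hg.1, IsFrac.mul hf.2 hg.2⟩
  · change ∃ g ∈ _, ∃ f, z * φ g = φ f
    obtain ⟨s, w, ⟨m, hw⟩, rfl⟩ := IsFrac.exists_sum hι hF hz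
    clear hz
    induction s using Finset.induction_on with
    | empty => exact ⟨1, one_mem _, 0, by simp⟩
    | insert n s hn ih =>
      obtain ⟨g, hg, f, h⟩ := ih
      suffices H : ∃ g ∈ Submonoid.closure (Set.range MvPolynomial.X), ∃ f, w n * φ g = φ f by
        obtain ⟨g', hg', f', h'⟩ := H
        refine ⟨g' * g, mul_mem hg' hg, f' * g + g' * f, ?_⟩
        rw [Finset.sum_insert hn, map_add, map_mul, map_mul, map_mul, ← h, ← h']
        ring
      by_cases hwn : w n = 0
      · exact ⟨1, one_mem _, 0, by simp [hwn]⟩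
      set e := b.repr ⟨n - m, w n, hwn, hw n⟩ with he
      have hy : HomFrac 𝒜 ι (n - m) (∏ i, x i ^ e i) := by
        have h1 := HomFrac.prod Finset.univ fun i => HomFrac.zpow hR hι (hx i) (e i)
        have h2 := congrArg Subtype.val (b.sum_repr ⟨n - m, w n, hwn, hw n⟩)
        rw [← he] at h2
        convert h1 using 1
        simpa using h2.symm
      have hy0 : ∏ i, x i ^ e i ≠ 0 := Finset.prod_ne_zero_iff.2 fun i _ => zpow_ne_zero _ (hx0 i)
      have hk : w n * (∏ i, x i ^ e i)⁻¹ ∈ k := by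
        have := HomFrac.mul (hw n) (HomFrac.inv hR hι hy)
        rwa [add_neg_cancel] at this
      refine ⟨∏ i, MvPolynomial.X i ^ (-e i).toNat,
        prod_mem fun i _ => pow_mem (Submonoid.subset_closure (Set.mem_range_self i)) _,
        MvPolynomial.C (⟨_, hk⟩ : k) * ∏ i, MvPolynomial.X i ^ (e i).toNat, ?_⟩
      have hpq : (∏ i, x i ^ e i) * ∏ i, x i ^ (-e i).toNat = ∏ i, x i ^ (e i).toNat := by
        rw [← Finset.prod_mul_distrib]
        refine Finset.prod_congr rfl fun i _ => ?_
        rw [← zpow_natCast, ← zpow_natCast, ← zpow_add₀ (hx0 i)]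
        congr 1
        omega
      simp only [map_mul, map_prod, map_pow, hφX, hφC]
      rw [← hpq, mul_assoc, inv_mul_cancel_left₀ hy0]

end Fractions

section Prime

universe u

open OreLocalization nonZeroDivisors in
/-- A noetherian domain embeds into a division ring whose center contains all fractions by
normal elements having the same twist as their denominator. -/
theorem exists_central_fractions (R : Type u) [Ring R] [IsDomain R] [IsNoetherianRing R] :
    ∃ (D F : Type u) (_ : Ring D) (_ : Field F) (_ : Algebra F D) (ι : R →+* D),
      Function.Injective ι ∧
      ∀ c v : R, c ≠ 0 → IsNormalElem c → Twist c v → ∃ z : F, z • ι c = ι v := by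
  obtain ⟨_⟩ := nonempty_oreSet_of_strongRankCondition (R := R)
  let D := OreLocalization R⁰ R
  let ι : R →+* D := numeratorRingHom
  have hι : Function.Injective ι := numeratorHom_inj (inf_le_left)
  refine ⟨D, Subring.center D, inferInstance, inferInstance, inferInstance, ι, hι,
    fun c v hc0 hc h => ?_⟩
  have hc0' : ι c ≠ 0 := (map_ne_zero_iff ι hι).2 hc0
  have hcomm : ∀ b, Commute (ι b) (ι v * (ι c)⁻¹) := by
    intro b
    obtain ⟨y, hy⟩ := IsNormalElem.exists_right hc b
    have h1 : ι y * (ι c)⁻¹ = (ι c)⁻¹ * ι b := by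
      rw [mul_inv_eq_iff_eq_mul₀ hc0', mul_assoc, eq_inv_mul_iff_mul_eq₀ hc0', ← map_mul,
        ← map_mul, hy]
    rw [Commute, SemiconjBy, ← mul_assoc, ← map_mul, ← h y b hy.symm, map_mul, mul_assoc, h1,
      mul_assoc]
  refine ⟨⟨ι v * (ι c)⁻¹, Subring.mem_center_iff.2 fun (q : D) => ?_⟩, ?_⟩
  · induction q using OreLocalization.ind with
    | c x s =>
      have hs : ι (s : R) * (x /ₒ s) = ι x := OreLocalization.mul_cancel
      have hs0 : ι (s : R) ≠ 0 := (map_ne_zero_iff ι hι).2 (nonZeroDivisors.ne_zero s.2)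
      rw [(eq_inv_mul_iff_mul_eq₀ hs0).2 hs]
      exact Commute.mul_left (Commute.inv_left₀ (hcomm _)) (hcomm _)
  · change ι v * (ι c)⁻¹ * ι c = ι v
    rw [inv_mul_cancel_right₀ hc0']

variable {K : Type*} [Field K] {R : Type*} [Ring R] [Algebra K R] {r : ℕ}
  (𝒜 : (Fin r → ℤ) → Submodule K R)
  {D F : Type*} [Ring D] [Field F] [Algebra F D] (ι : R →+* D)

/-- The scalar `z` is a fraction with numerator in `S`. -/
def IsFracIn (S : Set R) (z : F) : Prop := ∃ c ∈ primeMonoid 𝒜, ∃ s ∈ S, z • ι c = ι s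

variable {𝒜 ι} {S : Set R}

theorem IsFracIn.add {z w : F} (hS : IsIdealSet S) (hz : IsFracIn 𝒜 ι S z)
    (hw : IsFracIn 𝒜 ι S w) : IsFracIn 𝒜 ι S (z + w) := by
  obtain ⟨c, hc, u, hu, h⟩ := hz
  obtain ⟨d, hd, v, hv, h'⟩ := hw
  exact ⟨c * d, mul_mem hc hd, _, hS.2.1 _ (hS.2.2 _ _ hu).2 _ (hS.2.2 _ _ hv).1,
    add_smul_map_mul h h'⟩

theorem IsFracIn.mul_left {z w : F} (hS : IsIdealSet S) (hz : IsFrac 𝒜 ι z)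
    (hw : IsFracIn 𝒜 ι S w) : IsFracIn 𝒜 ι S (z * w) := by
  obtain ⟨c, hc, u, h⟩ := hz
  obtain ⟨d, hd, v, hv, h'⟩ := hw
  exact ⟨c * d, mul_mem hc hd, _, (hS.2.2 _ _ hv).1, mul_smul_map_mul h h'⟩

theorem IsFracIn.mem_or_mem (hι : Function.Injective ι) (hS : IsPrimeIdealSet S)
    (hSC : ∀ c ∈ primeMonoid 𝒜, c ∉ S) {z w : F} (hz : IsFrac 𝒜 ι z) (hw : IsFrac 𝒜 ι w)
    (h : IsFracIn 𝒜 ι S (z * w)) : IsFracIn 𝒜 ι S z ∨ IsFracIn 𝒜 ι S w := by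
  obtain ⟨c, hc, u, hu⟩ := hz
  obtain ⟨d, hd, v, hv⟩ := hw
  obtain ⟨e, he, s, hs, hes⟩ := h
  have hen := isNormalElem_of_mem_primeMonoid 𝒜 he
  obtain ⟨y, hy⟩ := IsNormalElem.exists_right hen (c * d)
  have key : u * v * e = s * y := by
    apply hι
    rw [map_mul, ← mul_smul_map_mul hu hv, smul_mul_assoc, ← map_mul, hy, map_mul,
      ← smul_mul_assoc, hes, map_mul]
  have h1 : u * v * e ∈ S := by rw [key]; exact (hS.1.2.2 _ _ hs).2
  have h2 := (IsPrimeIdealSet.mem_or_mem_right hS hen h1).resolve_right (hSC e he)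
  have hun := isNormalElem_of_smul_eq hι (isNormalElem_of_mem_primeMonoid 𝒜 hc) hu
  exact (IsPrimeIdealSet.mem_or_mem_left hS hun h2).imp (fun h => ⟨c, hc, u, h, hu⟩)
    fun h => ⟨d, hd, v, h, hv⟩

theorem IsFracIn.not_isFrac_inv (hι : Function.Injective ι) (hS : IsIdealSet S)
    (hSC : ∀ c ∈ primeMonoid 𝒜, c ∉ S) {z : F} (hz : z ≠ 0) (h : IsFracIn 𝒜 ι S z) :
    ¬ IsFrac 𝒜 ι z⁻¹ := by
  intro h'
  obtain ⟨c, hc, s, hs, e⟩ := IsFracIn.mul_left hS h' h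
  rw [inv_mul_cancel₀ hz, one_smul] at e
  exact hSC c hc (hι e ▸ hs)

variable [GradedAlgebra 𝒜]

/-- A nonzero prime ideal avoiding `primeMonoid` contains a prime central fraction. -/
theorem exists_prime_frac [IsDomain R] [IsNoetherianRing R] (hR : IsHUFDg 𝒜)
    (hι : Function.Injective ι)
    (hF : ∀ c v : R, c ≠ 0 → IsNormalElem c → Twist c v → ∃ z : F, z • ι c = ι v)
    (hS : IsPrimeIdealSet S) (hS0 : ∃ a ∈ S, a ≠ 0) (hSC : ∀ c ∈ primeMonoid 𝒜, c ∉ S) :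
    ∃ w : F, w ≠ 0 ∧ IsFracIn 𝒜 ι S w ∧ ∀ z z' y : F, IsFrac 𝒜 ι z → IsFrac 𝒜 ι z' →
      IsFrac 𝒜 ι y → z * z' = w * y →
      (∃ y', IsFrac 𝒜 ι y' ∧ z = w * y') ∨ ∃ y', IsFrac 𝒜 ι y' ∧ z' = w * y' := by
  obtain ⟨k, κ, φ, M, hφ, hφf, hMf, hsurj⟩ := exists_mvPolynomial hR hι hF
  have hone : IsFrac 𝒜 ι (1 : F) := HomFrac.isFrac HomFrac.one
  have h0 : ∀ {f}, f ≠ 0 → φ f ≠ 0 := fun hf => (map_ne_zero_iff φ hφ).2 hf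
  let Q : Ideal (MvPolynomial κ k) :=
    { carrier := {f | IsFracIn 𝒜 ι S (φ f)}
      add_mem' := fun {f g} hf hg => by
        change IsFracIn 𝒜 ι S (φ (f + g))
        rw [map_add]; exact IsFracIn.add hS.1 hf hg
      zero_mem' := ⟨1, one_mem _, 0, hS.1.1, by simp⟩
      smul_mem' := fun f g hg => by
        change IsFracIn 𝒜 ι S (φ (f * g))
        rw [map_mul]; exact IsFracIn.mul_left hS.1 (hφf f) hg }
  have hQ : ∀ f, f ∈ Q ↔ IsFracIn 𝒜 ι S (φ f) := fun f => Iff.rfl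
  have hMQ : ∀ g ∈ M, g ∉ Q := fun g hg hgQ =>
    IsFracIn.not_isFrac_inv hι hS.1 hSC (h0 (hMf g hg).1) hgQ (hMf g hg).2
  have hprime : Q.IsPrime := by
    refine ⟨fun h => ?_, fun {f g} h => ?_⟩
    · have h1 : IsFracIn 𝒜 ι S (φ 1) := (Ideal.eq_top_iff_one Q).1 h
      refine IsFracIn.not_isFrac_inv hι hS.1 hSC (h0 one_ne_zero) h1 ?_
      rw [map_one, inv_one]; exact hone
    · rw [hQ, map_mul] at h
      exact IsFracIn.mem_or_mem hι hS hSC (hφf f) (hφf g) h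
  have hne : Q ≠ ⊥ := by
    obtain ⟨a, ha, ha0⟩ := hS0
    obtain ⟨s, hs, -⟩ := exists_sum_proj 𝒜 a
    obtain ⟨v, hv, c, hc, m, -, -, -, -, hvc, htw⟩ := exists_twist_mem 𝒜 hR hS.1 ha ha0
      (E₀ := s) (g₀ := 0) fun n hn => hs n (by simpa using hn)
    have hc0 := ne_zero_of_mem_primeMonoid 𝒜 hc
    obtain ⟨z, hz⟩ := hF c v hc0 (isNormalElem_of_mem_primeMonoid 𝒜 hc) htw
    have hv0 : v ≠ 0 := by
      rintro rfl
      exact hc0 (by rw [← hvc, map_zero])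
    have hz0 : z ≠ 0 := by
      rintro rfl
      exact hv0 (hι (by rw [← hz, zero_smul, map_zero]))
    obtain ⟨g, hg, f, hf⟩ := hsurj z ⟨c, hc, v, hz⟩
    intro hbot
    have hfQ : f ∈ Q := by
      rw [hQ, ← hf, mul_comm]
      exact IsFracIn.mul_left hS.1 (hφf g) ⟨c, hc, v, hv, hz⟩
    rw [hbot, Ideal.mem_bot] at hfQ
    rw [hfQ, map_zero, mul_eq_zero] at hf
    exact h0 (hMf g hg).1 (hf.resolve_left hz0)
  obtain ⟨f, hfQ, hfp⟩ := Ideal.IsPrime.exists_mem_prime_of_ne_bot hprime hne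
  refine ⟨φ f, h0 hfp.ne_zero, hfQ, fun z z' y hz hz' hy h => ?_⟩
  obtain ⟨g₁, hg₁, f₁, h₁⟩ := hsurj z hz
  obtain ⟨g₂, hg₂, f₂, h₂⟩ := hsurj z' hz'
  obtain ⟨g, hg, f₃, h₃⟩ := hsurj y hy
  have key : f₁ * f₂ * g = f * (f₃ * g₁ * g₂) := by
    apply hφ
    simp only [map_mul, ← h₁, ← h₂, ← h₃]
    linear_combination (φ g₁ * φ g₂ * φ g) * h
  have hdvd : ∀ {z g₁ f₁}, g₁ ∈ M → z * φ g₁ = φ f₁ → f ∣ f₁ →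
      ∃ y', IsFrac 𝒜 ι y' ∧ z = φ f * y' := by
    rintro z g₁ _ hg₁ e ⟨t, rfl⟩
    refine ⟨φ t * (φ g₁)⁻¹, IsFrac.mul (hφf t) (hMf g₁ hg₁).2, ?_⟩
    rw [← mul_assoc, ← map_mul, eq_mul_inv_iff_mul_eq₀ (h0 (hMf g₁ hg₁).1), e]
  rcases hfp.dvd_or_dvd (⟨_, key⟩ : f ∣ f₁ * f₂ * g) with hd | hd
  · exact (hfp.dvd_or_dvd hd).imp (hdvd hg₁ h₁) (hdvd hg₂ h₂)
  · exact absurd (Ideal.mem_of_dvd Q hd hfQ) (hMQ g hg)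

omit [GradedAlgebra 𝒜] in
/-- A nonzero central fraction can be written with a numerator divisible by no homogeneous
prime, up to a factor in `primeMonoid`. -/
theorem exists_reduced_numerator [IsDomain R] [IsNoetherianRing R] (hι : Function.Injective ι)
    {w : F} (hw0 : w ≠ 0) (hw : IsFrac 𝒜 ι w) :
    ∃ u, u ≠ 0 ∧ IsNormalElem u ∧ (∃ c ∈ primeMonoid 𝒜, ∃ d ∈ primeMonoid 𝒜,
      w • ι c = ι (u * d)) ∧ ∀ p, IsPrimeElem p → (∃ m, p ∈ 𝒜 m) → ¬ NDvd p u := by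
  let N : Set R := {u | ∃ c ∈ primeMonoid 𝒜, ∃ d ∈ primeMonoid 𝒜, w • ι c = ι (u * d)}
  have hN : ∀ u ∈ N, u ≠ 0 ∧ IsNormalElem u := by
    rintro u ⟨c, hc, d, hd, h⟩
    refine ⟨?_, IsNormalElem.of_mul_right (isNormalElem_of_mem_primeMonoid 𝒜 hd)
      (ne_zero_of_mem_primeMonoid 𝒜 hd)
      (isNormalElem_of_smul_eq hι (isNormalElem_of_mem_primeMonoid 𝒜 hc) h)⟩
    rintro rfl
    rw [zero_mul, map_zero] at h
    exact hw0 (eq_zero_of_smul_eq_zero hι (ne_zero_of_mem_primeMonoid 𝒜 hc) h)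
  obtain ⟨c, hc, u₀, hu₀⟩ := hw
  obtain ⟨_, ⟨u, huN, rfl⟩, hmax⟩ := set_has_maximal_iff_noetherian.2
    (inferInstanceAs (IsNoetherian R R)) (Set.image (fun u => Ideal.span {u}) N)
    ⟨_, u₀, ⟨c, hc, 1, one_mem _, by rw [hu₀, mul_one]⟩, rfl⟩
  refine ⟨u, (hN u huN).1, (hN u huN).2, huN, ?_⟩
  rintro p hp hpm ⟨v, rfl⟩
  obtain ⟨c, hc, d, hd, h⟩ := huN
  have hvN : v ∈ N :=
    ⟨c, hc, p * d, mul_mem (Submonoid.subset_closure ⟨hp, hpm⟩) hd, by rw [h, mul_assoc]⟩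
  obtain ⟨hv0, hv⟩ := hN v hvN
  obtain ⟨y, hy⟩ := IsNormalElem.exists_left hv p
  have hle : Ideal.span {v * p} ≤ Ideal.span {v} := by
    rw [Ideal.span_singleton_le_iff_mem, hy]
    exact Ideal.mul_mem_left _ _ (Ideal.mem_span_singleton_self v)
  have hge : v ∈ Ideal.span {v * p} := by
    by_contra hnot
    refine hmax _ ⟨v, hvN, rfl⟩ (lt_of_le_not_ge hle fun hh => hnot ?_)
    exact hh (Ideal.mem_span_singleton_self v)
  obtain ⟨t, ht⟩ := Submodule.mem_span_singleton.1 hge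
  obtain ⟨t', ht'⟩ := IsNormalElem.exists_right hv t
  refine hp.2.2.1 ⟨t', mul_left_cancel₀ hv0 ?_⟩
  rw [mul_one, ← mul_assoc, ← ht', mul_assoc]
  exact ht.symm

omit [GradedAlgebra 𝒜] in
theorem nDvd_of_eq_mul [IsDomain R] (hι : Function.Injective ι) {w z y : F} {u c d c₁ v : R}
    (hu : IsNormalElem u) (hp : ∀ p, IsPrimeElem p → (∃ m, p ∈ 𝒜 m) → ¬ NDvd p u)
    (hc : c ∈ primeMonoid 𝒜) (hw : w • ι c = ι (u * d)) (hz : z • ι c₁ = ι v)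
    (hy : IsFrac 𝒜 ι y) (h : z = w * y) : NDvd u v := by
  obtain ⟨e, he, x, hx⟩ := hy
  obtain ⟨c₂, hc₂⟩ := IsNormalElem.exists_right (isNormalElem_of_mem_primeMonoid 𝒜 he) c₁
  obtain ⟨s, hs⟩ := IsNormalElem.exists_right (isNormalElem_of_mem_primeMonoid 𝒜 hc) (x * c₂)
  refine nDvd_of_nDvd_mul 𝒜 hu hp (mul_mem he hc) v ?_
  have key : v * (e * c) = u * (d * s) := by
    apply hι
    have h1 : ι (v * e) = w • ι (x * c₂) := by
      rw [map_mul, ← hz, smul_mul_assoc, ← map_mul, hc₂, h, map_mul, map_mul, ← hx,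
        smul_mul_assoc, smul_smul]
    rw [← mul_assoc, map_mul, h1, smul_mul_assoc, ← map_mul, hs, map_mul, ← smul_mul_assoc, hw,
      ← map_mul, mul_assoc]
  rw [key]
  exact IsNormalElem.exists_left hu _

/-- The reduced numerator of a prime central fraction generates a prime ideal. -/
theorem mem_or_mem_of_prime_frac [IsDomain R] [IsNoetherianRing R] (hR : IsHUFDg 𝒜)
    (hι : Function.Injective ι)
    (hF : ∀ c v : R, c ≠ 0 → IsNormalElem c → Twist c v → ∃ z : F, z • ι c = ι v)
    {w : F} (hw0 : w ≠ 0)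
    (hw : ∀ z z' y : F, IsFrac 𝒜 ι z → IsFrac 𝒜 ι z' → IsFrac 𝒜 ι y → z * z' = w * y →
      (∃ y', IsFrac 𝒜 ι y' ∧ z = w * y') ∨ ∃ y', IsFrac 𝒜 ι y' ∧ z' = w * y')
    {u c d : R} (hu : IsNormalElem u) (hc : c ∈ primeMonoid 𝒜) (hd : d ∈ primeMonoid 𝒜)
    (hwu : w • ι c = ι (u * d)) (hp : ∀ p, IsPrimeElem p → (∃ m, p ∈ 𝒜 m) → ¬ NDvd p u)
    {a b : R} (hab : ∀ t, NDvd u (a * t * b)) : NDvd u a ∨ NDvd u b := by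
  have hU := isIdealSet_multiples hu
  let I : Set R := {x | ∀ t, NDvd u (x * t * b)}
  let J : Set R := {y | ∀ x ∈ I, NDvd u (x * y)}
  have hI : IsIdealSet I := by
    refine ⟨fun t => ⟨0, by simp⟩, fun x hx y hy t => ?_, fun s x hx =>
      ⟨fun t => ?_, fun t => ?_⟩⟩
    · rw [add_mul, add_mul]; exact hU.2.1 _ (hx t) _ (hy t)
    · rw [mul_assoc s, mul_assoc s]; exact (hU.2.2 s _ (hx t)).1
    · rw [mul_assoc x]; exact hx _
  have hJ : IsIdealSet J := by
    refine ⟨fun x _ => ⟨0, by simp⟩, fun y hy y' hy' x hx => ?_, fun s y hy =>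
      ⟨fun x hx => ?_, fun x hx => ?_⟩⟩
    · rw [mul_add]; exact hU.2.1 _ (hy x hx) _ (hy' x hx)
    · rw [← mul_assoc]; exact hy _ (hI.2.2 s x hx).2
    · rw [← mul_assoc]; exact (hU.2.2 s _ (hy x hx)).2
  by_contra! hcon
  have ha : ¬ ∀ v ∈ I, ∀ c ∈ primeMonoid 𝒜, Twist c v → NDvd u v := fun h =>
    hcon.1 (subset_of_twist_mem 𝒜 hR hI hu hp h hab)
  have hb : ¬ ∀ v ∈ J, ∀ c ∈ primeMonoid 𝒜, Twist c v → NDvd u v := fun h =>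
    hcon.2 (subset_of_twist_mem 𝒜 hR hJ hu hp h fun x hx => by simpa using hx 1)
  push Not at ha hb
  obtain ⟨v₁, hv₁, c₁, hc₁, ht₁, hn₁⟩ := ha
  obtain ⟨v₂, hv₂, c₂, hc₂, ht₂, hn₂⟩ := hb
  obtain ⟨z₁, hz₁⟩ := hF c₁ v₁ (ne_zero_of_mem_primeMonoid 𝒜 hc₁)
    (isNormalElem_of_mem_primeMonoid 𝒜 hc₁) ht₁
  obtain ⟨z₂, hz₂⟩ := hF c₂ v₂ (ne_zero_of_mem_primeMonoid 𝒜 hc₂)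
    (isNormalElem_of_mem_primeMonoid 𝒜 hc₂) ht₂
  obtain ⟨t, ht⟩ := hv₂ v₁ hv₁
  have hy : IsFrac 𝒜 ι (w⁻¹ * (z₁ * z₂)) := by
    refine ⟨c₁ * c₂ * d, mul_mem (mul_mem hc₁ hc₂) hd, t * c, ?_⟩
    rw [map_mul, mul_smul, ← smul_mul_assoc, mul_smul_map_mul hz₁ hz₂, ht, ← map_mul, mul_assoc,
      map_mul, ← hwu, mul_smul_comm, smul_smul, inv_mul_cancel₀ hw0, one_smul, map_mul]
  rcases hw z₁ z₂ _ ⟨c₁, hc₁, v₁, hz₁⟩ ⟨c₂, hc₂, v₂, hz₂⟩ hy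
    (mul_inv_cancel_left₀ hw0 _).symm with ⟨y, hy, e⟩ | ⟨y, hy, e⟩
  · exact hn₁ (nDvd_of_eq_mul hι hu hp hc hwu hz₁ hy e)
  · exact hn₂ (nDvd_of_eq_mul hι hu hp hc hwu hz₂ hy e)

end Prime

end HUFD

/-- **Theorem 2.4 (Launois–Lenagan–Rigal)**: a noetherian `H`-UFD (for a
rational torus action encoded by a `ℤʳ`-grading) is a UFR. -/
theorem stmt5 {K : Type*} [Field K] {R : Type*} [Ring R] [Algebra K R]
    [IsDomain R] [IsNoetherianRing R] [IsNoetherianRing Rᵐᵒᵖ]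
    {r : ℕ} (𝒜 : (Fin r → ℤ) → Submodule K R) [GradedAlgebra 𝒜]
    (hR : IsHUFDg 𝒜) :
    ∀ S : Set R, IsPrimeIdealSet S → S ≠ {0} →
      ∃ u : R, u ≠ 0 ∧ IsNormalElem u ∧
        IsPrimeIdealSet {y : R | ∃ t : R, y = t * u} ∧
        {y : R | ∃ t : R, y = t * u} ⊆ S := by
  intro S hS hS0
  have hne : ∃ a ∈ S, a ≠ 0 := by
    by_contra! h
    exact hS0 (Set.eq_singleton_iff_unique_mem.2 ⟨hS.1.1, h⟩)
  by_cases hSC : ∀ c ∈ HUFD.primeMonoid 𝒜, c ∉ S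
  · obtain ⟨D, F, _, _, _, ι, hι, hF⟩ := HUFD.exists_central_fractions R
    obtain ⟨w, hw0, ⟨c₀, hc₀, s, hs, hws⟩, hw⟩ :=
      HUFD.exists_prime_frac hR hι hF hS hne hSC
    obtain ⟨u, hu0, hu, ⟨c, hc, d, hd, hwu⟩, hp⟩ :=
      HUFD.exists_reduced_numerator hι hw0 ⟨c₀, hc₀, s, hws⟩
    have huS : u ∈ S := by
      obtain ⟨y, hy⟩ := HUFD.IsNormalElem.exists_right
        (HUFD.isNormalElem_of_mem_primeMonoid 𝒜 hc₀) c
      have key : u * (d * c₀) = s * y := by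
        apply hι
        rw [← mul_assoc, map_mul, ← hwu, smul_mul_assoc, ← map_mul, hy, map_mul,
          ← smul_mul_assoc, hws, map_mul]
      have hdc := mul_mem hd hc₀
      exact (HUFD.IsPrimeIdealSet.mem_or_mem_right hS
        (HUFD.isNormalElem_of_mem_primeMonoid 𝒜 hdc)
        (key ▸ (hS.1.2.2 y s hs).2)).resolve_right (hSC _ hdc)
    have hsub : {y : R | ∃ t : R, y = t * u} ⊆ S := by
      rintro _ ⟨t, rfl⟩
      exact (hS.1.2.2 t u huS).1
    exact ⟨u, hu0, hu, ⟨HUFD.isIdealSet_multiples hu, fun h => hS.2.1 (hsub h), fun a b hab =>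
      HUFD.mem_or_mem_of_prime_frac hR hι hF hw0 hw hu hc hd hwu hp hab⟩, hsub⟩
  · push Not at hSC
    obtain ⟨c, hc, hcS⟩ := hSC
    obtain ⟨p, hpS, hp⟩ := HUFD.exists_prime_of_mem_primeMonoid 𝒜 hS hc hcS
    refine ⟨p, hp.1, hp.2.1, HUFD.IsPrimeElem.isPrimeIdealSet hp, ?_⟩
    rintro _ ⟨t, rfl⟩
    exact (hS.1.2.2 t p hpS).1
end
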